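/- Let n ≥ 3 and let d > 2 be an odd composite square-free integer all of whose prime divisors are congruent to ±3 (mod 8) or to 9 (mod 16). Let r be the number of prime divisors of d congruent to 3 or 5 (mod 8), q the number congruent to 9 (mod 16), and t = 4q + 2r. If d has prime divisors p₁ ≡ 5 (mod 8) and p₂ ≡ 3 (mod 8), then rank_2(Cl(Q(ζ_{2^n}, √d))) = t − 3. -/

import Mathlib

open NumberField IntermediateField

/-- The 2-rank of the class group: dim_{F₂} Cl(K)/Cl(K)². -/
noncomputable def rank2 (K : Type*) [Field K] [NumberField K] : ℕ :=
  Nat.log 2 (Nat.card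
    (ClassGroup (𝓞 K) ⧸ Subgroup.closure {x : ClassGroup (𝓞 K) | ∃ y, x = y ^ 2}))

set_option linter.unusedSectionVars false

namespace AmbiguousClass

section Index

variable {G H : Type*} [CommGroup G] [CommGroup H]

lemma relIndex_map_of_ker_le (f : G →* H) {A B : Subgroup G} (hk : f.ker ≤ A) :
    (A.map f).relIndex (B.map f) = A.relIndex B := by
  rw [← Subgroup.relIndex_comap, Subgroup.comap_map_eq_self hk]

/-- The homomorphism `x ↦ x / σ x`. -/
def twist (σ : G →* G) : G →* G := MonoidHom.id G / σ

/-- The homomorphism `x ↦ x * σ x`. -/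
def nm (σ : G →* G) : G →* G := MonoidHom.id G * σ

@[simp] lemma twist_apply (σ : G →* G) (x : G) : twist σ x = x / σ x := rfl

@[simp] lemma nm_apply (σ : G →* G) (x : G) : nm σ x = x * σ x := rfl

lemma mem_ker_twist {σ : G →* G} {x : G} : x ∈ (twist σ).ker ↔ σ x = x := by
  rw [MonoidHom.mem_ker, twist_apply, div_eq_one, eq_comm]

lemma nm_twist {σ : G →* G} (hσ : ∀ x, σ (σ x) = x) (x : G) : nm σ (twist σ x) = 1 := by
  simp [hσ]

lemma range_twist {σ : G →* G} (hσ : ∀ x, σ (σ x) = x)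
    (h90 : ∀ x, x * σ x = 1 → ∃ y, x = y / σ y) : (twist σ).range = (nm σ).ker := by
  ext x
  constructor
  · rintro ⟨y, rfl⟩
    exact nm_twist hσ y
  · intro hx
    obtain ⟨y, rfl⟩ := h90 x hx
    exact ⟨y, rfl⟩

/-- The index computation behind Chevalley's ambiguous class number formula, for two groups
with involutions and an equivariant homomorphism `f` (the divisor of an element). -/
theorem chevalley_index (σ : G →* G) (τ : H →* H) (f : G →* H)
    (hσ : ∀ x, σ (σ x) = x) (hτ : ∀ x, τ (τ x) = x) (hf : ∀ x, f (σ x) = τ (f x))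
    (hσ90 : ∀ x, x * σ x = 1 → ∃ y, x = y / σ y)
    (hτ90 : ∀ x, x * τ x = 1 → ∃ y, x = y / τ y) :
    f.range.relIndex (f.range.comap (twist τ)) *
      ((f.ker.map (twist σ)).relIndex (f.ker ⊓ (nm σ).ker)) =
    ((twist σ).ker.map f).relIndex (twist τ).ker *
      (f.ker.map (nm σ)).relIndex (f.ker ⊓ (nm σ).range) := by
  have r1 := range_twist hσ hσ90
  have r2 := range_twist hτ hτ90
  have hft : ∀ x, f (twist σ x) = twist τ (f x) := fun x ↦ by simp [hf]
  have hfn : ∀ x, f (nm σ x) = nm τ (f x) := fun x ↦ by simp [hf]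
  set P := f.range with hP
  set J := (twist τ).ker with hJ
  set M := P.comap (twist τ) with hM
  have hJM : J ≤ M := fun x hx ↦ by
    rw [hM, Subgroup.mem_comap, (MonoidHom.mem_ker).1 hx]; exact one_mem _
  have hPM : P ≤ M := by
    rintro _ ⟨x, rfl⟩
    exact ⟨twist σ x, hft x⟩
  have e1 : P.relIndex (P ⊔ J) * (P ⊔ J).relIndex M = P.relIndex M :=
    Subgroup.relIndex_mul_relIndex _ _ _ le_sup_left (sup_le hPM hJM)
  rw [Subgroup.relIndex_sup_left] at e1
  -- the classes of invariant divisors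
  have e2 : ((twist σ).ker.map f).relIndex (P ⊓ J) * (P ⊓ J).relIndex J =
      ((twist σ).ker.map f).relIndex J := by
    refine Subgroup.relIndex_mul_relIndex _ _ _ (le_inf ?_ ?_) inf_le_right
    · rintro _ ⟨x, -, rfl⟩; exact ⟨x, rfl⟩
    · rintro _ ⟨x, hx, rfl⟩
      rw [hJ, MonoidHom.mem_ker, ← hft, (MonoidHom.mem_ker).1 hx, map_one]
  rw [Subgroup.inf_relIndex_right] at e2
  have e3 : ((twist σ).ker.map f).relIndex (P ⊓ J) =
      (f.ker.map (twist σ)).relIndex (f.ker ⊓ (nm σ).ker) := by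
    have m1 : (f.ker.comap (twist σ)).map f = P ⊓ J := by
      ext y
      constructor
      · rintro ⟨x, hx, rfl⟩
        refine ⟨⟨x, rfl⟩, ?_⟩
        have : f (twist σ x) = 1 := hx
        change twist τ (f x) = 1
        rw [← hft, this]
      · rintro ⟨⟨x, rfl⟩, hx⟩
        refine ⟨x, ?_, rfl⟩
        have : twist τ (f x) = 1 := hx
        change f (twist σ x) = 1
        rw [hft, this]
    have m2 : ((twist σ).ker ⊔ f.ker).map f = (twist σ).ker.map f := by
      rw [Subgroup.map_sup, (Subgroup.map_eq_bot_iff _).2 le_rfl, sup_bot_eq]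
    have m3 : ((twist σ).ker ⊔ f.ker).map (twist σ) = f.ker.map (twist σ) := by
      rw [Subgroup.map_sup, (Subgroup.map_eq_bot_iff _).2 le_rfl, bot_sup_eq]
    have m4 : (f.ker.comap (twist σ)).map (twist σ) = f.ker ⊓ (nm σ).ker := by
      rw [Subgroup.map_comap_eq, r1, inf_comm]
    rw [← m1, ← m2, ← m3, ← m4, relIndex_map_of_ker_le _ le_sup_right,
      relIndex_map_of_ker_le _ le_sup_left]
  -- the remaining ambiguous classes
  have e4 : (P ⊔ J).relIndex M = (f.ker.map (nm σ)).relIndex (f.ker ⊓ (nm σ).range) := by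
    set X := f.ker.comap (nm σ) with hX
    set Y := (twist σ).range ⊔ f.ker with hY
    have m1 : M.map (twist τ) = X.map f := by
      ext y
      constructor
      · rintro ⟨D, ⟨x, hx⟩, rfl⟩
        refine ⟨x, ?_, hx⟩
        change f (nm σ x) = 1
        rw [hfn, hx, nm_twist hτ]
      · rintro ⟨x, hx, rfl⟩
        have : nm τ (f x) = 1 := by rw [← hfn]; exact hx
        obtain ⟨D, hD⟩ := hτ90 _ this
        exact ⟨D, ⟨x, hD⟩, hD.symm⟩
    have m2 : (P ⊔ J).map (twist τ) = Y.map f := by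
      rw [Subgroup.map_sup, (Subgroup.map_eq_bot_iff _).2 le_rfl, sup_bot_eq, hY,
        Subgroup.map_sup, (Subgroup.map_eq_bot_iff f.ker).2 le_rfl, sup_bot_eq]
      ext y
      constructor
      · rintro ⟨_, ⟨x, rfl⟩, rfl⟩
        exact ⟨_, ⟨x, rfl⟩, hft x⟩
      · rintro ⟨_, ⟨x, rfl⟩, rfl⟩
        exact ⟨_, ⟨x, rfl⟩, (hft x).symm⟩
    have m3 : X.map (nm σ) = f.ker ⊓ (nm σ).range := by
      rw [Subgroup.map_comap_eq, inf_comm]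
    have m4 : Y.map (nm σ) = f.ker.map (nm σ) := by
      rw [hY, r1, Subgroup.map_sup, (Subgroup.map_eq_bot_iff _).2 le_rfl, bot_sup_eq]
    rw [← m3, ← m4, relIndex_map_of_ker_le _ (r1 ▸ le_sup_left),
      ← relIndex_map_of_ker_le f (le_sup_right : f.ker ≤ Y), ← m1, ← m2,
      relIndex_map_of_ker_le _ le_sup_right]
  rw [← e1, e4, ← e2, e3]
  ring

/-- The Herbrand quotient of a group with involution in terms of the indices of the subgroups of
squares of its invariant and its anti-invariant part. -/
theorem herbrand_index (σ : G →* G) (hσ : ∀ x, σ (σ x) = x) (E : Subgroup G)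
    (hE : ∀ x ∈ E, σ x ∈ E) :
    ((E ⊓ (nm σ).ker).map (powMonoidHom 2)).relIndex (E ⊓ (nm σ).ker) *
      (E.map (nm σ)).relIndex (E ⊓ (twist σ).ker) =
    ((E ⊓ (twist σ).ker).map (powMonoidHom 2)).relIndex (E ⊓ (twist σ).ker) *
      (E.map (twist σ)).relIndex (E ⊓ (nm σ).ker) := by
  set A := E ⊓ (twist σ).ker with hA
  set B := E ⊓ (nm σ).ker with hB
  have a1 : A.map (nm σ) = A.map (powMonoidHom 2) := by
    refine SetLike.coe_injective (Set.image_congr fun x hx ↦ ?_)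
    rw [nm_apply, mem_ker_twist.1 hx.2, powMonoidHom_apply, sq]
  have b1 : B.map (twist σ) = B.map (powMonoidHom 2) := by
    refine SetLike.coe_injective (Set.image_congr fun x hx ↦ ?_)
    have : x * σ x = 1 := hx.2
    rw [twist_apply, powMonoidHom_apply, sq, eq_inv_of_mul_eq_one_right this, div_inv_eq_mul]
  have aB : A.map (twist σ) = ⊥ := (Subgroup.map_eq_bot_iff _).2 inf_le_right
  have bA : B.map (nm σ) = ⊥ := (Subgroup.map_eq_bot_iff _).2 inf_le_right
  have hAB : A ⊔ B ≤ E := sup_le inf_le_left inf_le_left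
  have key : ∀ g : G →* G, E ⊓ g.ker ≤ A ⊔ B →
      ((A ⊔ B).map g).relIndex (E.map g) = (A ⊔ B).relIndex E := by
    intro g hg
    rw [Subgroup.relIndex_map_map, ← Subgroup.inf_relIndex_right, ← Subgroup.inf_relIndex_right,
      ← Subgroup.inf_relIndex_right (A ⊔ B) E]
    have : (A ⊔ B ⊔ g.ker) ⊓ (E ⊔ g.ker) = A ⊔ B ⊔ g.ker :=
      inf_eq_left.2 (sup_le_sup_right hAB _)
    rw [this, inf_eq_left.2 (sup_le_sup_right hAB _)]
    have h2 : (A ⊔ B ⊔ g.ker) ⊔ E = E ⊔ g.ker := by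
      rw [sup_right_comm, sup_eq_right.2 hAB]
    rw [← h2, sup_comm _ E, Subgroup.relIndex_sup_right, inf_eq_left.2 hAB,
      ← Subgroup.inf_relIndex_right]
    congr 1
    rw [sup_inf_assoc_of_le _ hAB, sup_eq_left, inf_comm]
    exact hg
  have k1 := key (nm σ) le_sup_right
  have k2 := key (twist σ) le_sup_left
  rw [Subgroup.map_sup, a1, bA, sup_bot_eq] at k1
  rw [Subgroup.map_sup, b1, aB, bot_sup_eq] at k2
  have i1 : A.map (powMonoidHom 2) ≤ E.map (nm σ) := a1 ▸ Subgroup.map_mono inf_le_left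
  have i2 : E.map (nm σ) ≤ A := by
    rintro _ ⟨x, hx, rfl⟩
    exact ⟨E.mul_mem hx (hE x hx), mem_ker_twist.2 (by simp [hσ, mul_comm])⟩
  have i3 : B.map (powMonoidHom 2) ≤ E.map (twist σ) := b1 ▸ Subgroup.map_mono inf_le_left
  have i4 : E.map (twist σ) ≤ B := by
    rintro _ ⟨x, hx, rfl⟩
    exact ⟨E.div_mem hx (hE x hx), nm_twist hσ x⟩
  rw [← Subgroup.relIndex_mul_relIndex _ _ _ i1 i2, ← Subgroup.relIndex_mul_relIndex _ _ _ i3 i4,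
    k1, k2]
  ring

end Index

section Squares

/-- Reduction modulo two of the coordinates in `T`. -/
noncomputable def modTwo {X : Type*} (T : Set X) : (X →₀ ℤ) →+ (T → ZMod 2) where
  toFun D x := (D x : ZMod 2)
  map_zero' := by ext; simp
  map_add' D D' := by ext; simp

lemma modTwo_surjective {X : Type*} {T : Set X} (hT : T.Finite) :
    Function.Surjective (modTwo T) := by
  classical
  intro g
  have := hT.fintype
  let h : X → ℤ := fun x ↦ if hx : x ∈ T then ((g ⟨x, hx⟩).val : ℤ) else 0
  refine ⟨Finsupp.onFinset hT.toFinset h fun x hx ↦ ?_, ?_⟩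
  · by_contra h'
    exact hx (dif_neg fun h'' ↦ h' (hT.mem_toFinset.2 h''))
  · ext ⟨x, hx⟩
    simp [modTwo, h, hx]

lemma index_ker_modTwo {X : Type*} {T : Set X} (hT : T.Finite) :
    (modTwo T).ker.index = 2 ^ T.ncard := by
  have := hT.fintype
  rw [AddSubgroup.index_ker, AddMonoidHom.range_eq_top.2 (modTwo_surjective hT)]
  rw [Nat.card_congr AddSubgroup.topEquiv.toEquiv, Nat.card_fun, Nat.card_zmod,
    Nat.card_coe_set_eq]

lemma mem_ker_modTwo {X : Type*} {T : Set X} {D : X →₀ ℤ} :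
    D ∈ (modTwo T).ker ↔ ∀ x ∈ T, 2 ∣ D x := by
  rw [AddMonoidHom.mem_ker, funext_iff]
  simp [modTwo, ZMod.intCast_zmod_eq_zero_iff_dvd _ 2]

lemma index_two_nsmul_finsupp (n : ℕ) :
    (nsmulAddMonoidHom (α := Fin n →₀ ℤ) 2).range.index = 2 ^ n := by
  have h := index_ker_modTwo (Set.finite_univ (α := Fin n))
  rw [Set.ncard_univ, Nat.card_fin] at h
  rw [← h]
  congr 1
  ext D
  rw [mem_ker_modTwo]
  constructor
  · rintro ⟨D, rfl⟩ x -
    simp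
  · intro hD
    choose f hf using fun x ↦ hD x (Set.mem_univ x)
    exact ⟨Finsupp.equivFunOnFinite.symm f, by ext x; simp [hf]⟩

lemma index_two_nsmul_of_finite (T : Type*) [AddCommGroup T] [Finite T] :
    (nsmulAddMonoidHom (α := T) 2).range.index = Nat.card (nsmulAddMonoidHom (α := T) 2).ker :=
  AddSubgroup.index_range

lemma index_two_nsmul_congr {M N : Type*} [AddCommGroup M] [AddCommGroup N] (φ : M ≃+ N) :
    (nsmulAddMonoidHom (α := M) 2).range.index = (nsmulAddMonoidHom (α := N) 2).range.index := by
  rw [← AddSubgroup.index_map_equiv _ φ]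
  congr 1
  ext y
  constructor
  · rintro ⟨_, ⟨x, rfl⟩, rfl⟩
    exact ⟨φ x, by simp⟩
  · rintro ⟨x, rfl⟩
    exact ⟨_, ⟨φ.symm x, rfl⟩, by simp⟩

lemma card_two_torsion_congr {M N : Type*} [AddCommGroup M] [AddCommGroup N] (φ : M ≃+ N) :
    Nat.card (nsmulAddMonoidHom (α := M) 2).ker = Nat.card (nsmulAddMonoidHom (α := N) 2).ker := by
  refine Nat.card_congr (φ.toEquiv.subtypeEquiv fun x ↦ ?_)
  simp only [AddMonoidHom.mem_ker, nsmulAddMonoidHom_apply]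
  change _ ↔ 2 • φ x = 0
  rw [← map_nsmul, map_eq_zero_iff _ φ.injective]

/-- For a finitely generated abelian group `M` one has `[M : 2M] = 2 ^ rank M * |M[2]|`. -/
theorem index_two_nsmul (M : Type*) [AddCommGroup M] [Module.Finite ℤ M] :
    (nsmulAddMonoidHom (α := M) 2).range.index =
      2 ^ Module.finrank ℤ M * Nat.card (nsmulAddMonoidHom (α := M) 2).ker := by
  have : AddGroup.FG M := Module.Finite.iff_addGroup_fg.1 ‹_›
  obtain ⟨n, ι, _, p, hp, e, ⟨φ⟩⟩ := AddCommGroup.equiv_free_prod_directSum_zmod M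
  have : ∀ i, NeZero (p i ^ e i) := fun i ↦ ⟨pow_ne_zero _ (hp i).ne_zero⟩
  let ψ := φ.trans ((AddEquiv.refl (Fin n →₀ ℤ)).prodCongr (DirectSum.addEquivProd _))
  set T := ∀ i, ZMod (p i ^ e i) with hT
  have hr : Module.finrank ℤ M = n := by
    rw [ψ.toIntLinearEquiv.finrank_eq, ← Submodule.finrank_quotient_add_finrank
        (LinearMap.ker (LinearMap.fst ℤ (Fin n →₀ ℤ) T)),
      ((LinearMap.fst ℤ (Fin n →₀ ℤ) T).quotKerEquivOfSurjective
        LinearMap.fst_surjective).finrank_eq, Module.finrank_finsupp_self,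
      Fintype.card_fin, Nat.add_eq_left, Module.finrank_eq_zero_iff_isTorsion]
    have : Finite T := inferInstance
    rintro ⟨⟨x, t⟩, hx⟩
    obtain rfl : x = 0 := hx
    refine ⟨⟨Nat.card T, by simp [Nat.card_pos.ne']⟩, ?_⟩
    ext1
    refine Prod.ext (smul_zero _) ?_
    change (Nat.card T : ℤ) • t = 0
    rw [natCast_zsmul, card_nsmul_eq_zero']
  have h1 : (nsmulAddMonoidHom (α := (Fin n →₀ ℤ) × T) 2).range =
      (nsmulAddMonoidHom (α := Fin n →₀ ℤ) 2).range.prod (nsmulAddMonoidHom (α := T) 2).range := by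
    ext ⟨x, t⟩
    constructor
    · rintro ⟨⟨y, s⟩, h⟩
      exact ⟨⟨y, congrArg Prod.fst h⟩, ⟨s, congrArg Prod.snd h⟩⟩
    · rintro ⟨⟨y, h⟩, ⟨s, h'⟩⟩
      exact ⟨(y, s), Prod.ext h h'⟩
  have h2 : Nat.card (nsmulAddMonoidHom (α := (Fin n →₀ ℤ) × T) 2).ker =
      Nat.card (nsmulAddMonoidHom (α := T) 2).ker := by
    refine Nat.card_congr
      ⟨fun x ↦ ⟨x.1.2, congrArg Prod.snd x.2⟩, fun t ↦ ⟨(0, t.1), Prod.ext (smul_zero _) t.2⟩,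
        fun ⟨⟨x, t⟩, h⟩ ↦ ?_, fun t ↦ rfl⟩
    have h0 : 2 • x = 0 := congrArg Prod.fst h
    have : x = 0 := by
      ext i
      simpa using DFunLike.congr_fun h0 i
    subst this
    rfl
  rw [index_two_nsmul_congr ψ, card_two_torsion_congr ψ, hr, h1, h2, AddSubgroup.index_prod,
    index_two_nsmul_finsupp, index_two_nsmul_of_finite]

/-- For a finitely generated abelian group `A` one has `[A : A²] = 2 ^ rank A * |A[2]|`. -/
theorem relIndex_squares {G : Type*} [CommGroup G] (A : Subgroup G)
    [Module.Finite ℤ (Additive A)] :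
    (A.map (powMonoidHom 2)).relIndex A =
      2 ^ Module.finrank ℤ (Additive A) * Nat.card {x : A // x ^ 2 = 1} := by
  have h := index_two_nsmul (Additive A)
  have h1 : (nsmulAddMonoidHom (α := Additive A) 2).range.index =
      (A.map (powMonoidHom 2)).relIndex A := by
    rw [Subgroup.relIndex, ← Subgroup.index_toAddSubgroup]
    congr 1
    ext x
    constructor
    · rintro ⟨y, rfl⟩
      exact ⟨y.toMul.1, y.toMul.2, rfl⟩
    · rintro ⟨y, hy, h⟩
      exact ⟨Additive.ofMul ⟨y, hy⟩, Subtype.ext h⟩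
  rw [← h1, h]
  rfl

end Squares

section Divisors

open IsDedekindDomain nonZeroDivisors

variable (R : Type*) [CommRing R] [IsDedekindDomain R] (F : Type*) [Field F] [Algebra R F]
  [IsFractionRing R F]

/-- The group of divisors of a Dedekind domain. -/
abbrev DivGroup : Type _ := Multiplicative (HeightOneSpectrum R →₀ ℤ)

open scoped Classical in
/-- The factorization of an invertible fractional ideal. -/
noncomputable def idealDiv : (FractionalIdeal R⁰ F)ˣ →* DivGroup R where
  toFun I := .ofAdd (Finsupp.ofSupportFinite (fun v ↦ FractionalIdeal.count F v I)
    (FractionalIdeal.finite_factors (I : FractionalIdeal R⁰ F)))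
  map_one' := by
    apply Multiplicative.toAdd.injective
    ext v
    simp [Finsupp.ofSupportFinite, FractionalIdeal.count_one]
  map_mul' I J := by
    apply Multiplicative.toAdd.injective
    ext v
    exact FractionalIdeal.count_mul F v I.ne_zero J.ne_zero

lemma idealDiv_apply (I : (FractionalIdeal R⁰ F)ˣ) (v : HeightOneSpectrum R) :
    (idealDiv R F I).toAdd v = FractionalIdeal.count F v I := rfl

lemma idealDiv_bijective : Function.Bijective (idealDiv R F) := by
  constructor
  · intro I J h
    ext1
    rw [← FractionalIdeal.finprod_heightOneSpectrum_factorization' F I.ne_zero,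
      ← FractionalIdeal.finprod_heightOneSpectrum_factorization' F J.ne_zero]
    simp_rw [← idealDiv_apply, h]
  · intro D
    have h0 : (D.toAdd.prod fun v n ↦ (v.asIdeal : FractionalIdeal R⁰ F) ^ n) ≠ 0 :=
      Finset.prod_ne_zero_iff.2 fun v _ ↦
        zpow_ne_zero _ (FractionalIdeal.coeIdeal_ne_zero.2 v.ne_bot)
    refine ⟨Units.mk0 _ h0, ?_⟩
    apply Multiplicative.toAdd.injective
    ext v
    rw [idealDiv_apply, Units.val_mk0, FractionalIdeal.count_finsuppProd]

/-- The divisor of a nonzero element of the fraction field. -/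
noncomputable def elemDiv : Fˣ →* DivGroup R := (idealDiv R F).comp (toPrincipalIdeal R F)

lemma index_range_elemDiv : (elemDiv R F).range.index = Nat.card (ClassGroup R) := by
  rw [elemDiv, MonoidHom.range_comp, Subgroup.index_map_of_bijective (idealDiv_bijective R F),
    Subgroup.index_eq_card]
  exact Nat.card_congr (ClassGroup.equiv F).symm.toEquiv

lemma valuation_eq_exp (x : Fˣ) (v : HeightOneSpectrum R) :
    v.valuation F (x : F) = WithZero.exp (-(elemDiv R F x).toAdd v) := by
  classical
  have key : ∀ (r : R) (hr : r ≠ 0) (y : Fˣ), (y : F) = algebraMap R F r →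
      v.valuation F (y : F) = WithZero.exp (-(elemDiv R F y).toAdd v) := by
    intro r hr y hy
    rw [hy, HeightOneSpectrum.valuation_of_algebraMap, HeightOneSpectrum.intValuation_if_neg _ hr,
      elemDiv, MonoidHom.comp_apply, idealDiv_apply, coe_toPrincipalIdeal, hy,
      ← FractionalIdeal.coeIdeal_span_singleton, FractionalIdeal.count_coe]
    simpa using hr
  obtain ⟨a, b, hb, hab⟩ := IsFractionRing.div_surjective (A := R) (x : F)
  have hb0 : algebraMap R F b ≠ 0 := by simpa using nonZeroDivisors.ne_zero hb
  have ha0 : algebraMap R F a ≠ 0 := by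
    intro h
    rw [h, zero_div] at hab
    exact x.ne_zero hab.symm
  have hx : x = Units.mk0 _ ha0 / Units.mk0 _ hb0 := by ext; simp [hab]
  rw [hx, Units.val_div_eq_div_val, map_div₀, key a (by simpa using ha0) _ rfl,
    key b (by simpa using hb0) _ rfl, map_div, ← WithZero.exp_sub, toAdd_div, Finsupp.sub_apply]
  congr 1
  ring

lemma elemDiv_eq_one_iff (x : Fˣ) :
    elemDiv R F x = 1 ↔ ∃ u : Rˣ, algebraMap R F u = x := by
  constructor
  · intro h
    have hv : ∀ v : HeightOneSpectrum R, v.valuation F (x : F) = 1 := fun v ↦ by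
      simp [valuation_eq_exp, h]
    obtain ⟨a, ha⟩ := HeightOneSpectrum.mem_integers_of_valuation_le_one F (x : F)
      fun v ↦ (hv v).le
    obtain ⟨b, hb⟩ := HeightOneSpectrum.mem_integers_of_valuation_le_one (R := R) F
      ((x : F)⁻¹) fun v ↦ by rw [map_inv₀, hv v, inv_one]
    have hab : a * b = 1 := IsFractionRing.injective R F (by simp [ha, hb])
    exact ⟨Units.mkOfMulEqOne a b hab, ha⟩
  · rintro ⟨u, hu⟩
    apply Multiplicative.toAdd.injective
    ext v
    have h1 : v.valuation F (x : F) = 1 := by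
      rw [← hu, HeightOneSpectrum.valuation_eq_one_iff_notMem]
      exact fun h ↦ v.isPrime.ne_top (Ideal.eq_top_of_isUnit_mem _ h u.isUnit)
    rw [valuation_eq_exp, ← WithZero.exp_zero, WithZero.exp_inj] at h1
    simpa using h1

end Divisors

section Involution

open IsDedekindDomain nonZeroDivisors Pointwise

variable {K L : Type*} [Field K] [NumberField K] [Field L] [NumberField L] [Algebra K L]

/-- The action of an automorphism on the primes. -/
noncomputable def smulPrime (σ : Gal(L/K)) (v : HeightOneSpectrum (𝓞 L)) :
    HeightOneSpectrum (𝓞 L) where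
  asIdeal := σ • v.asIdeal
  isPrime := inferInstance
  ne_bot h := v.ne_bot (by
    rw [← inv_smul_smul σ v.asIdeal, h, Ideal.pointwise_smul_def, Ideal.map_bot])

@[simp] lemma smulPrime_asIdeal (σ : Gal(L/K)) (v : HeightOneSpectrum (𝓞 L)) :
    (smulPrime σ v).asIdeal = σ • v.asIdeal := rfl

instance : SMulCommClass Gal(L/K) (𝓞 K) (𝓞 L) where
  smul_comm σ a b := by
    rw [Algebra.smul_def, Algebra.smul_def, smul_mul']
    congr 1
    exact RingOfIntegers.ext (σ.commutes (a : K))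

lemma smulPrime_under (σ : Gal(L/K)) (v : HeightOneSpectrum (𝓞 L)) :
    (smulPrime σ v).under (𝓞 K) = v.under (𝓞 K) := by
  ext1
  exact Ideal.under_smul (𝓞 K) v.asIdeal σ

lemma valuation_smulPrime (σ : Gal(L/K)) (v : HeightOneSpectrum (𝓞 L)) (x : L) :
    (smulPrime σ v).valuation L (σ x) = v.valuation L x := by
  have key : ∀ r : 𝓞 L, (smulPrime σ v).intValuation (σ • r) = v.intValuation r := by
    intro r
    by_cases hr : r = 0
    · simp [hr]
    · rw [HeightOneSpectrum.intValuation_eq_exp_neg_multiplicity _ hr,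
        HeightOneSpectrum.intValuation_eq_exp_neg_multiplicity _ ((smul_ne_zero_iff_ne σ).2 hr)]
      have h1 : Ideal.span {σ • r} = σ • Ideal.span {r} := by
        rw [Ideal.pointwise_smul_def, Ideal.map_span, Set.image_singleton]
        rfl
      rw [h1]
      congr 3
      exact multiplicity_map_eq (MulDistribMulAction.toMulEquiv (Ideal (𝓞 L)) σ)
  obtain ⟨a, b, hb, rfl⟩ := IsFractionRing.div_surjective (A := 𝓞 L) x
  have ha : ∀ a : 𝓞 L, σ (algebraMap (𝓞 L) L a) = algebraMap (𝓞 L) L (σ • a) := fun a ↦ rfl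
  rw [map_div₀, map_div₀, map_div₀, ha, ha]
  simp only [HeightOneSpectrum.valuation_of_algebraMap, key]

/-- The ramification index of a prime of `K` in a Galois extension `L`. -/
noncomputable def ramIdx (L : Type*) [Field L] [NumberField L] [Algebra K L]
    (P : HeightOneSpectrum (𝓞 K)) : ℕ := P.asIdeal.ramificationIdxIn (𝓞 L)

lemma valuation_algebraMap [IsGalois K L] (v : HeightOneSpectrum (𝓞 L)) (x : K) :
    v.valuation L (algebraMap K L x) =
      (v.under (𝓞 K)).valuation K x ^ ramIdx L (v.under (𝓞 K)) := by
  have : v.asIdeal.LiesOver (v.under (𝓞 K)).asIdeal := ⟨rfl⟩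
  rw [← HeightOneSpectrum.valuation_liesOver L (v.under (𝓞 K)) v, ramIdx,
    Ideal.ramificationIdx'_eq_ramificationIdx _ _ (v.under (𝓞 K)).ne_bot,
    Ideal.ramificationIdxIn_eq_ramificationIdx _ v.asIdeal Gal(L/K)]

lemma elemDiv_algebraMap [IsGalois K L] (v : HeightOneSpectrum (𝓞 L)) (x : Kˣ) :
    (elemDiv (𝓞 L) L (Units.map (algebraMap K L) x)).toAdd v =
      ramIdx L (v.under (𝓞 K)) * (elemDiv (𝓞 K) K x).toAdd (v.under (𝓞 K)) := by
  have h := valuation_algebraMap v (x : K)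
  have h2 : algebraMap K L x = (Units.map (algebraMap K L : K →* L) x : L) := rfl
  rw [h2, valuation_eq_exp, valuation_eq_exp, ← WithZero.exp_nsmul, WithZero.exp_inj] at h
  simp only [nsmul_eq_mul] at h
  linarith

lemma elemDiv_apply_smulPrime (σ : Gal(L/K)) (v : HeightOneSpectrum (𝓞 L)) (x : Lˣ) :
    (elemDiv (𝓞 L) L (Units.map (σ : L →* L) x)).toAdd (smulPrime σ v) =
      (elemDiv (𝓞 L) L x).toAdd v := by
  have h := valuation_smulPrime σ v (x : L)
  have h2 : σ (x : L) = (Units.map (σ : L →* L) x : L) := rfl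
  rw [h2, valuation_eq_exp, valuation_eq_exp, WithZero.exp_inj] at h
  linarith

lemma exists_under_eq (P : HeightOneSpectrum (𝓞 K)) :
    ∃ v : HeightOneSpectrum (𝓞 L), v.under (𝓞 K) = P := by
  obtain ⟨⟨Q, hQ, hQ'⟩⟩ := (inferInstance : Nonempty (P.asIdeal.primesOver (𝓞 L)))
  refine ⟨⟨Q, hQ, Ideal.ne_bot_of_liesOver_of_ne_bot P.ne_bot Q⟩, ?_⟩
  ext1
  exact hQ'.over.symm

lemma exists_smulPrime_eq [IsGalois K L] {v w : HeightOneSpectrum (𝓞 L)}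
    (h : v.under (𝓞 K) = w.under (𝓞 K)) : ∃ σ : Gal(L/K), smulPrime σ v = w := by
  have h1 : v.asIdeal.LiesOver (v.under (𝓞 K)).asIdeal := ⟨rfl⟩
  have h2 : w.asIdeal.LiesOver (v.under (𝓞 K)).asIdeal := h ▸ ⟨rfl⟩
  obtain ⟨σ, hσ⟩ := Ideal.exists_smul_eq_of_isGaloisGroup (v.under (𝓞 K)).asIdeal v.asIdeal
    w.asIdeal Gal(L/K)
  exact ⟨σ, HeightOneSpectrum.ext hσ⟩

lemma ramIdx_pos [IsGalois K L] (P : HeightOneSpectrum (𝓞 K)) : ramIdx L P ≠ 0 :=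
  Ideal.ramificationIdxIn_ne_zero Gal(L/K)

lemma ramIdx_le [IsGalois K L] (P : HeightOneSpectrum (𝓞 K)) :
    ramIdx L P ∣ Module.finrank K L := by
  have := Ideal.ncard_primesOver_mul_ramificationIdxIn_mul_inertiaDegIn P.asIdeal (𝓞 L) Gal(L/K)
  rw [IsGalois.card_aut_eq_finrank] at this
  rw [← this]
  exact (Dvd.intro _ rfl).mul_left _

instance (P : HeightOneSpectrum (𝓞 K)) : Finite P.asIdeal.ResidueField := by
  infer_instance

/-- In a totally ramified Galois extension the Galois group acts trivially on residues. -/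
lemma smul_sub_mem [IsGalois K L] (v : HeightOneSpectrum (𝓞 L))
    (h : ramIdx L (v.under (𝓞 K)) = Module.finrank K L) (σ : Gal(L/K)) (x : 𝓞 L) :
    σ • x - x ∈ v.asIdeal := by
  have h1 : v.asIdeal.LiesOver (v.under (𝓞 K)).asIdeal := ⟨rfl⟩
  have := Ideal.card_inertia_eq_ramificationIdxIn (G := Gal(L/K)) (v.under (𝓞 K)).asIdeal
    v.asIdeal
  rw [← ramIdx, h, ← IsGalois.card_aut_eq_finrank, Subgroup.card_eq_iff_eq_top] at this
  have hm : σ ∈ Ideal.inertia Gal(L/K) v.asIdeal := this ▸ Subgroup.mem_top _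
  exact hm x

/-- In a totally ramified Galois extension the Galois group fixes the primes. -/
lemma smulPrime_eq [IsGalois K L] (v : HeightOneSpectrum (𝓞 L))
    (h : ramIdx L (v.under (𝓞 K)) = Module.finrank K L) (σ : Gal(L/K)) :
    smulPrime σ v = v := by
  ext x
  rw [smulPrime_asIdeal, Ideal.mem_pointwise_smul_iff_inv_smul_mem]
  have := smul_sub_mem v h σ⁻¹ x
  exact ⟨fun hx ↦ by simpa using sub_mem hx this, fun hx ↦ by simpa using add_mem this hx⟩

/-- In a totally ramified Galois extension there is no residue extension. -/
lemma exists_sub_algebraMap_mem [IsGalois K L] (v : HeightOneSpectrum (𝓞 L))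
    (h : ramIdx L (v.under (𝓞 K)) = Module.finrank K L) (x : 𝓞 L) :
    ∃ y : 𝓞 K, x - algebraMap (𝓞 K) (𝓞 L) y ∈ v.asIdeal := by
  have h1 : v.asIdeal.LiesOver (v.under (𝓞 K)).asIdeal := ⟨rfl⟩
  have hn : Module.finrank K L ≠ 0 := Module.finrank_pos.ne'
  have hf := Ideal.ncard_primesOver_mul_ramificationIdxIn_mul_inertiaDegIn
    (v.under (𝓞 K)).asIdeal (𝓞 L) Gal(L/K)
  rw [← ramIdx, h, IsGalois.card_aut_eq_finrank, mul_left_comm, Nat.mul_eq_left hn,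
    mul_eq_one, Ideal.inertiaDegIn_eq_inertiaDeg _ v.asIdeal Gal(L/K)] at hf
  have hf2 := hf.2
  rw [Ideal.inertiaDeg_eq_of_isMaximal (v.under (𝓞 K)).asIdeal] at hf2
  let _ := Ideal.Quotient.field (v.under (𝓞 K)).asIdeal
  obtain ⟨c, hc⟩ := (finrank_eq_one_iff_of_nonzero' (1 : 𝓞 L ⧸ v.asIdeal) one_ne_zero).1 hf2
    (Ideal.Quotient.mk v.asIdeal x)
  obtain ⟨y, rfl⟩ := Ideal.Quotient.mk_surjective c
  refine ⟨y, (Ideal.Quotient.mk_eq_mk_iff_sub_mem _ _).1 ?_⟩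
  rw [← hc, Algebra.smul_def, mul_one]
  rfl

end Involution

section Quadratic

open IsDedekindDomain nonZeroDivisors Pointwise

variable {K L : Type*} [Field K] [NumberField K] [Field L] [NumberField L] [Algebra K L]

lemma smulPrime_smulPrime (σ ρ : Gal(L/K)) (v : HeightOneSpectrum (𝓞 L)) :
    smulPrime σ (smulPrime ρ v) = smulPrime (σ * ρ) v := by
  ext1
  simp [mul_smul]

lemma smulPrime_one (v : HeightOneSpectrum (𝓞 L)) : smulPrime (1 : Gal(L/K)) v = v := by
  ext1
  simp

lemma isGalois_of_finrank (h2 : Module.finrank K L = 2) : IsGalois K L := by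
  have : Algebra.IsQuadraticExtension K L := ⟨h2⟩
  infer_instance

lemma eq_one_or_eq (h2 : Module.finrank K L = 2) {σ : Gal(L/K)} (hσ : σ ≠ 1) (ρ : Gal(L/K)) :
    ρ = 1 ∨ ρ = σ := by
  have := isGalois_of_finrank h2
  have hc : Nat.card Gal(L/K) = 2 := by rw [IsGalois.card_aut_eq_finrank, h2]
  obtain ⟨a, b, hab, huniv⟩ := Nat.card_eq_two_iff.1 hc
  have key : ∀ x : Gal(L/K), x = a ∨ x = b := fun x ↦ by
    have : x ∈ ({a, b} : Set Gal(L/K)) := huniv ▸ Set.mem_univ x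
    simpa using this
  rcases key 1 with h1 | h1 <;> rcases key σ with h3 | h3 <;> rcases key ρ with h4 | h4 <;> simp_all

lemma mul_self_eq_one (h2 : Module.finrank K L = 2) (σ : Gal(L/K)) : σ * σ = 1 := by
  by_cases hσ : σ = 1
  · simp [hσ]
  · rcases eq_one_or_eq h2 hσ (σ * σ) with h | h
    · exact h
    · exact absurd (mul_eq_left.1 h) hσ

lemma apply_apply (h2 : Module.finrank K L = 2) (σ : Gal(L/K)) (x : L) : σ (σ x) = x := by
  rw [← AlgEquiv.mul_apply, mul_self_eq_one h2 σ, AlgEquiv.one_apply]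

lemma exists_algebraMap_eq (h2 : Module.finrank K L = 2) {σ : Gal(L/K)} (hσ : σ ≠ 1) {x : L}
    (hx : σ x = x) : ∃ y : K, algebraMap K L y = x := by
  have := isGalois_of_finrank h2
  refine (IsGalois.mem_range_algebraMap_iff_fixed x).2 fun ρ ↦ ?_
  rcases eq_one_or_eq h2 hσ ρ with rfl | rfl
  · rfl
  · exact hx

lemma exists_eq_div (h2 : Module.finrank K L = 2) {σ : Gal(L/K)} (hσ : σ ≠ 1) {x : L}
    (hx : x * σ x = 1) : ∃ y ≠ 0, x = y / σ y := by
  have hx0 : x ≠ 0 := left_ne_zero_of_mul_eq_one hx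
  by_cases h : 1 + x = 0
  · obtain ⟨z, hz⟩ : ∃ z, σ z ≠ z := by
      by_contra! hc
      exact hσ (AlgEquiv.ext hc)
    have hz' : z - σ z ≠ 0 := sub_ne_zero.2 hz.symm
    refine ⟨z - σ z, hz', ?_⟩
    rw [map_sub, apply_apply h2, ← neg_sub z, div_neg, div_self hz']
    linear_combination h
  · refine ⟨1 + x, h, ?_⟩
    have h' : σ (1 + x) ≠ 0 := (map_ne_zero_iff σ σ.injective).2 h
    rw [eq_div_iff h', map_add, map_one, mul_add, hx, mul_one, add_comm]

/-- A chosen prime above a given one. -/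
noncomputable def primeAbove (L : Type*) [Field L] [NumberField L] [Algebra K L]
    (P : HeightOneSpectrum (𝓞 K)) : HeightOneSpectrum (𝓞 L) := (exists_under_eq (L := L) P).choose

@[simp] lemma primeAbove_under (P : HeightOneSpectrum (𝓞 K)) :
    (primeAbove L P).under (𝓞 K) = P := (exists_under_eq (L := L) P).choose_spec

lemma eq_or_smulPrime_eq (h2 : Module.finrank K L = 2) {σ : Gal(L/K)} (hσ : σ ≠ 1)
    {v w : HeightOneSpectrum (𝓞 L)} (h : v.under (𝓞 K) = w.under (𝓞 K)) :
    w = v ∨ w = smulPrime σ v := by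
  have := isGalois_of_finrank h2
  obtain ⟨ρ, rfl⟩ := exists_smulPrime_eq h
  rcases eq_one_or_eq h2 hσ ρ with rfl | rfl
  · exact .inl (smulPrime_one v)
  · exact .inr rfl

lemma smulPrime_involutive (h2 : Module.finrank K L = 2) (σ : Gal(L/K)) :
    Function.Involutive (smulPrime σ) := fun v ↦ by
  rw [smulPrime_smulPrime, mul_self_eq_one h2, smulPrime_one]

/-- The action of an involution on divisors. -/
noncomputable def divAct (h2 : Module.finrank K L = 2) (σ : Gal(L/K)) :
    DivGroup (𝓞 L) →* DivGroup (𝓞 L) :=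
  AddMonoidHom.toMultiplicative (Finsupp.domCongr
    (Function.Involutive.toPerm (smulPrime σ) (smulPrime_involutive h2 σ))).toAddMonoidHom

lemma divAct_apply (h2 : Module.finrank K L = 2) (σ : Gal(L/K)) (D : DivGroup (𝓞 L))
    (v : HeightOneSpectrum (𝓞 L)) :
    (divAct h2 σ D).toAdd v = D.toAdd (smulPrime σ v) := rfl

lemma divAct_divAct (h2 : Module.finrank K L = 2) (σ : Gal(L/K)) (D : DivGroup (𝓞 L)) :
    divAct h2 σ (divAct h2 σ D) = D := by
  apply Multiplicative.toAdd.injective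
  ext v
  rw [divAct_apply, divAct_apply, smulPrime_involutive h2]

lemma divAct_elemDiv (h2 : Module.finrank K L = 2) (σ : Gal(L/K)) (x : Lˣ) :
    elemDiv (𝓞 L) L (Units.map (σ : L →* L) x) = divAct h2 σ (elemDiv (𝓞 L) L x) := by
  apply Multiplicative.toAdd.injective
  ext v
  rw [divAct_apply, ← elemDiv_apply_smulPrime σ (smulPrime σ v) x, smulPrime_involutive h2]

open scoped Classical in
lemma exists_eq_div_divAct (h2 : Module.finrank K L = 2) {σ : Gal(L/K)} (hσ : σ ≠ 1)
    {D : DivGroup (𝓞 L)} (hD : D * divAct h2 σ D = 1) : ∃ B, D = B / divAct h2 σ B := by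
  have hD' : ∀ v, D.toAdd v + D.toAdd (smulPrime σ v) = 0 := fun v ↦ by
    rw [← divAct_apply h2 σ, ← Finsupp.add_apply, ← toAdd_mul, hD]
    rfl
  refine ⟨.ofAdd (D.toAdd.filter fun v ↦ v = primeAbove L (v.under (𝓞 K))), ?_⟩
  apply Multiplicative.toAdd.injective
  ext v
  rw [toAdd_div, Finsupp.sub_apply, divAct_apply, toAdd_ofAdd, Finsupp.filter_apply,
    Finsupp.filter_apply, smulPrime_under]
  have h1 := hD' v
  have h3 : primeAbove L (v.under (𝓞 K)) = v ∨ primeAbove L (v.under (𝓞 K)) = smulPrime σ v :=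
    eq_or_smulPrime_eq h2 hσ (by simp)
  grind

lemma finite_under_eq (P : HeightOneSpectrum (𝓞 K)) :
    {v : HeightOneSpectrum (𝓞 L) | v.under (𝓞 K) = P}.Finite := by
  refine Set.Finite.of_injOn (f := HeightOneSpectrum.asIdeal) (t := P.asIdeal.primesOver (𝓞 L))
    ?_ (fun v _ w _ h ↦ HeightOneSpectrum.ext h) (IsDedekindDomain.primesOver_finite P.asIdeal (𝓞 L))
  rintro v rfl
  exact ⟨v.isPrime, ⟨rfl⟩⟩

/-- Pulling back divisors as functions on the set of primes. -/
noncomputable def divPull (K L : Type*) [Field K] [NumberField K] [Field L] [NumberField L]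
    [Algebra K L] : DivGroup (𝓞 K) →* DivGroup (𝓞 L) where
  toFun C := .ofAdd (Finsupp.ofSupportFinite (fun v ↦ C.toAdd (v.under (𝓞 K))) (by
    exact Set.Finite.preimage' (f := fun v : HeightOneSpectrum (𝓞 L) ↦ v.under (𝓞 K))
      C.toAdd.hasFiniteSupport fun P _ ↦ finite_under_eq P))
  map_one' := by
    apply Multiplicative.toAdd.injective
    ext v
    rfl
  map_mul' C D := by
    apply Multiplicative.toAdd.injective
    ext v
    rfl

lemma divPull_apply (C : DivGroup (𝓞 K)) (v : HeightOneSpectrum (𝓞 L)) :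
    (divPull K L C).toAdd v = C.toAdd (v.under (𝓞 K)) := rfl

lemma divPull_injective : Function.Injective (divPull K L) := fun C D h ↦ by
  apply Multiplicative.toAdd.injective
  ext P
  rw [← primeAbove_under (L := L) P, ← divPull_apply, h, divPull_apply]

lemma range_divPull (h2 : Module.finrank K L = 2) {σ : Gal(L/K)} (hσ : σ ≠ 1) :
    (divPull K L).range = (twist (divAct h2 σ)).ker := by
  ext D
  rw [mem_ker_twist]
  constructor
  · rintro ⟨C, rfl⟩
    apply Multiplicative.toAdd.injective
    ext v
    rw [divAct_apply, divPull_apply, divPull_apply, smulPrime_under]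
  · intro h
    have h' : ∀ v, D.toAdd (smulPrime σ v) = D.toAdd v := fun v ↦ by rw [← divAct_apply h2, h]
    have hi : Function.Injective (primeAbove (K := K) L) := fun P Q hPQ ↦ by
      rw [← primeAbove_under (L := L) P, hPQ, primeAbove_under]
    refine ⟨.ofAdd (D.toAdd.comapDomain (primeAbove L) hi.injOn), ?_⟩
    · apply Multiplicative.toAdd.injective
      ext v
      rw [divPull_apply, toAdd_ofAdd, Finsupp.comapDomain_apply]
      have h3 : primeAbove L (v.under (𝓞 K)) = v ∨ primeAbove L (v.under (𝓞 K)) = smulPrime σ v :=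
        eq_or_smulPrime_eq h2 hσ (by simp)
      rcases h3 with h3 | h3
      · rw [h3]
      · rw [h3, h']

/-- Multiplication by the ramification indices. -/
noncomputable def divRam (K L : Type*) [Field K] [NumberField K] [Field L] [NumberField L]
    [Algebra K L] : DivGroup (𝓞 K) →* DivGroup (𝓞 K) where
  toFun C := .ofAdd (Finsupp.ofSupportFinite (fun P ↦ ramIdx L P * C.toAdd P) (by
    refine C.toAdd.hasFiniteSupport.subset fun P hP ↦ ?_
    exact right_ne_zero_of_mul hP))
  map_one' := by
    apply Multiplicative.toAdd.injective
    ext P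
    exact mul_zero _
  map_mul' C D := by
    apply Multiplicative.toAdd.injective
    ext P
    exact mul_add _ _ _

lemma divRam_apply (C : DivGroup (𝓞 K)) (P : HeightOneSpectrum (𝓞 K)) :
    (divRam K L C).toAdd P = ramIdx L P * C.toAdd P := rfl

lemma divRam_injective [IsGalois K L] : Function.Injective (divRam K L) := fun C D h ↦ by
  apply Multiplicative.toAdd.injective
  ext P
  have : (divRam K L C).toAdd P = (divRam K L D).toAdd P := by rw [h]
  rw [divRam_apply, divRam_apply] at this
  exact mul_left_cancel₀ (by exact_mod_cast ramIdx_pos P) this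

/-- The set of ramified primes. -/
def ramSet (K L : Type*) [Field K] [NumberField K] [Field L] [NumberField L] [Algebra K L] :
    Set (HeightOneSpectrum (𝓞 K)) := {P | ramIdx L P ≠ 1}

lemma ramIdx_eq_two (h2 : Module.finrank K L = 2) {P : HeightOneSpectrum (𝓞 K)}
    (hP : P ∈ ramSet K L) : ramIdx L P = 2 := by
  have := isGalois_of_finrank h2
  have h := ramIdx_le (L := L) P
  rw [h2] at h
  exact ((Nat.dvd_prime Nat.prime_two).1 h).resolve_left hP

lemma range_divRam (h2 : Module.finrank K L = 2) :
    (divRam K L).range = (modTwo (ramSet K L)).ker.toSubgroup := by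
  ext C
  have hC : C ∈ (modTwo (ramSet K L)).ker.toSubgroup ↔ ∀ P ∈ ramSet K L, 2 ∣ C.toAdd P :=
    mem_ker_modTwo (D := C.toAdd)
  rw [hC]
  constructor
  · rintro ⟨D, rfl⟩ P hP
    rw [divRam_apply, ramIdx_eq_two h2 hP]
    exact Dvd.intro _ rfl
  · intro h
    refine ⟨.ofAdd (Finsupp.ofSupportFinite (fun P ↦ C.toAdd P / ramIdx L P) ?_), ?_⟩
    · refine C.toAdd.hasFiniteSupport.subset fun P hP h0 ↦ hP ?_
      simp [h0]
    · apply Multiplicative.toAdd.injective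
      ext P
      rw [divRam_apply, toAdd_ofAdd, Finsupp.ofSupportFinite_coe]
      refine Int.mul_ediv_cancel' ?_
      by_cases hP : P ∈ ramSet K L
      · rw [ramIdx_eq_two h2 hP]
        exact h P hP
      · rw [not_not.1 hP]
        simp

lemma divPull_divRam_elemDiv [IsGalois K L] (x : Kˣ) :
    elemDiv (𝓞 L) L (Units.map (algebraMap K L) x) =
      divPull K L (divRam K L (elemDiv (𝓞 K) K x)) := by
  apply Multiplicative.toAdd.injective
  ext v
  rw [divPull_apply, divRam_apply, elemDiv_algebraMap]

lemma ker_twist_map (h2 : Module.finrank K L = 2) {σ : Gal(L/K)} (hσ : σ ≠ 1) :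
    (twist (Units.map (σ : L →* L))).ker = (Units.map (algebraMap K L : K →* L)).range := by
  ext x
  rw [mem_ker_twist]
  constructor
  · intro h
    obtain ⟨y, hy⟩ := exists_algebraMap_eq h2 hσ (x := (x : L)) (congrArg Units.val h)
    have hy0 : y ≠ 0 := by
      rintro rfl
      exact x.ne_zero (by rw [← hy, map_zero])
    exact ⟨Units.mk0 y hy0, Units.ext hy⟩
  · rintro ⟨y, rfl⟩
    exact Units.ext (σ.commutes (y : K))

lemma relIndex_invariant_divisors (h2 : Module.finrank K L = 2) {σ : Gal(L/K)} (hσ : σ ≠ 1)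
    (hT : (ramSet K L).Finite) :
    ((twist (Units.map (σ : L →* L))).ker.map (elemDiv (𝓞 L) L)).relIndex
      (twist (divAct h2 σ)).ker = Nat.card (ClassGroup (𝓞 K)) * 2 ^ (ramSet K L).ncard := by
  have := isGalois_of_finrank h2
  have h1 : (twist (Units.map (σ : L →* L))).ker.map (elemDiv (𝓞 L) L) =
      (((elemDiv (𝓞 K) K).range.map (divRam K L))).map (divPull K L) := by
    rw [ker_twist_map h2 hσ, MonoidHom.map_range, MonoidHom.map_range, MonoidHom.map_range]
    congr 1
    ext1 x
    exact divPull_divRam_elemDiv x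
  rw [h1, ← range_divPull h2 hσ, MonoidHom.range_eq_map (divPull K L), relIndex_map_of_ker_le _
    (by rw [(MonoidHom.ker_eq_bot_iff _).2 divPull_injective]; exact bot_le),
    Subgroup.relIndex_top_right, ← index_ker_modTwo hT, ← AddSubgroup.index_toSubgroup,
    ← range_divRam h2,
    ← Subgroup.relIndex_mul_index (Subgroup.map_le_range _ _), MonoidHom.range_eq_map (divRam K L),
    relIndex_map_of_ker_le _ (by
      rw [(MonoidHom.ker_eq_bot_iff _).2 divRam_injective]; exact bot_le),
    Subgroup.relIndex_top_right, index_range_elemDiv]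

end Quadratic

section UnitIndex

open IsDedekindDomain nonZeroDivisors Pointwise

variable {K L : Type*} [Field K] [NumberField K] [Field L] [NumberField L] [Algebra K L]

/-- The units of `K` which are norms of elements of `L`. -/
noncomputable def normUnits (K L : Type*) [Field K] [NumberField K] [Field L] [NumberField L]
    [Algebra K L] : Subgroup (𝓞 K)ˣ :=
  (Units.map (Algebra.norm K : L →* K)).range.comap (Units.map (algebraMap (𝓞 K) K : 𝓞 K →* K))

lemma mem_normUnits {u : (𝓞 K)ˣ} :
    u ∈ normUnits K L ↔ ∃ y : L, Algebra.norm K y = algebraMap (𝓞 K) K u := by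
  constructor
  · rintro ⟨y, hy⟩
    exact ⟨y, congrArg Units.val hy⟩
  · rintro ⟨y, hy⟩
    have hy0 : y ≠ 0 := by
      rintro rfl
      rw [Algebra.norm_zero] at hy
      exact (u.isUnit.map (algebraMap (𝓞 K) K)).ne_zero hy.symm
    exact ⟨Units.mk0 y hy0, Units.ext hy⟩

lemma algebraMap_norm (h2 : Module.finrank K L = 2) {σ : Gal(L/K)} (hσ : σ ≠ 1) (y : L) :
    algebraMap K L (Algebra.norm K y) = y * σ y := by
  classical
  have := isGalois_of_finrank h2
  rw [Algebra.norm_eq_prod_automorphisms]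
  have : (Finset.univ : Finset Gal(L/K)) = {1, σ} := by
    ext ρ
    simpa using eq_one_or_eq h2 hσ ρ
  rw [this, Finset.prod_pair hσ.symm, AlgEquiv.one_apply]

lemma finrank_eq_add_finrank_ker {M N : Type*} [AddCommGroup M] [AddCommGroup N]
    [Module.Finite ℤ M] [Module.Finite ℤ N] (f : M →ₗ[ℤ] N)
    (hf : ∀ y, (2 : ℤ) • y ∈ LinearMap.range f) :
    Module.finrank ℤ M = Module.finrank ℤ N + Module.finrank ℤ (LinearMap.ker f) := by
  have h1 := (LinearMap.ker f).finrank_quotient_add_finrank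
  rw [f.quotKerEquivRange.finrank_eq] at h1
  have h2 := (LinearMap.range f).finrank_quotient_add_finrank
  suffices h3 : Module.finrank ℤ (N ⧸ LinearMap.range f) = 0 by omega
  rw [Module.finrank_eq_zero_iff_isTorsion]
  intro x
  obtain ⟨y, rfl⟩ := Submodule.Quotient.mk_surjective _ x
  refine ⟨⟨2, by simp⟩, ?_⟩
  exact (Submodule.Quotient.mk_eq_zero _).2 (hf y)

lemma card_two_torsion {F : Type*} [CommRing F] [IsDomain F] [CharZero F] (A : Subgroup Fˣ)
    (h : -1 ∈ A) : Nat.card {x : A // x ^ 2 = 1} = 2 := by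
  have h1 : (-1 : Fˣ) ≠ 1 := by
    intro h
    have h' : (-1 : F) = 1 := congrArg Units.val h
    have h3 : (2 : F) = 0 := by linear_combination -h'
    exact two_ne_zero h3
  rw [Nat.card_eq_two_iff]
  refine ⟨⟨1, one_pow _⟩, ⟨⟨-1, h⟩, Subtype.ext neg_one_sq⟩, ?_, ?_⟩
  · intro h3
    exact h1 (congrArg (fun z : {x : A // x ^ 2 = 1} ↦ ((z : A) : Fˣ)) h3).symm
  · ext ⟨⟨x, hxA⟩, hx⟩
    have hx1 : x ^ 2 = 1 := congrArg Subtype.val hx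
    have hx2 : (x : F) ^ 2 = 1 := congrArg Units.val hx1
    simp only [Set.mem_insert_iff, Set.mem_singleton_iff, Set.mem_univ, iff_true, Subtype.ext_iff]
    rcases mul_self_eq_one_iff.1 ((sq (x : F)).symm.trans hx2) with h | h
    · exact .inl (Units.ext h)
    · exact .inr (Units.ext h)

lemma rank_eq (h2 : Module.finrank K L = 2) [IsTotallyComplex K] :
    Units.rank L = 2 * Units.rank K + 1 := by
  have hL : IsTotallyComplex L := by
    refine ⟨fun w ↦ ?_⟩
    have h := IsTotallyComplex.isComplex (w.comap (algebraMap K L))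
    rw [← InfinitePlace.not_isReal_iff_isComplex] at h ⊢
    exact fun h' ↦ h (h'.comap _)
  have h3 := Module.finrank_mul_finrank ℚ K L
  rw [h2, IsTotallyComplex.finrank K, IsTotallyComplex.finrank L] at h3
  have h4 := InfinitePlace.card_eq_nrRealPlaces_add_nrComplexPlaces K
  have h5 := InfinitePlace.card_eq_nrRealPlaces_add_nrComplexPlaces L
  have h6 : InfinitePlace.nrRealPlaces K = 0 := IsTotallyComplex.nrRealPlaces_eq_zero K
  have h7 : InfinitePlace.nrRealPlaces L = 0 := IsTotallyComplex.nrRealPlaces_eq_zero L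
  have h8 : 0 < Fintype.card (InfinitePlace K) := Fintype.card_pos
  simp only [Units.rank]
  omega

/-- The inclusion of the unit group of the ring of integers. -/
noncomputable def unitIncl (F : Type*) [Field F] : (𝓞 F)ˣ →* Fˣ :=
  Units.map (algebraMap (𝓞 F) F : 𝓞 F →* F)

lemma unitIncl_injective (F : Type*) [Field F] : Function.Injective (unitIncl F) :=
  Units.map_injective RingOfIntegers.coe_injective

lemma ker_elemDiv (F : Type*) [Field F] [NumberField F] :
    (elemDiv (𝓞 F) F).ker = (unitIncl F).range := by
  ext x
  rw [MonoidHom.mem_ker, elemDiv_eq_one_iff]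
  constructor
  · rintro ⟨u, hu⟩
    exact ⟨u, Units.ext hu⟩
  · rintro ⟨u, rfl⟩
    exact ⟨u, rfl⟩

lemma finrank_of_mulEquiv {A B : Type*} [CommGroup A] [CommGroup B] (e : A ≃* B) :
    Module.finrank ℤ (Additive A) = Module.finrank ℤ (Additive B) :=
  (MulEquiv.toAdditive e).toIntLinearEquiv.finrank_eq

lemma finite_of_injective {A B : Type*} [CommGroup A] [CommGroup B]
    [Module.Finite ℤ (Additive B)] (f : A →* B) (hf : Function.Injective f) :
    Module.Finite ℤ (Additive A) :=
  Module.Finite.of_injective (MonoidHom.toAdditive f).toIntLinearMap hf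

lemma ker_elemDiv_inf_ker_twist (h2 : Module.finrank K L = 2) {σ : Gal(L/K)} (hσ : σ ≠ 1) :
    (elemDiv (𝓞 L) L).ker ⊓ (twist (Units.map (σ : L →* L))).ker =
      ((Units.map (algebraMap K L : K →* L)).comp (unitIncl K)).range := by
  have := isGalois_of_finrank h2
  ext x
  rw [ker_twist_map h2 hσ, Subgroup.mem_inf, MonoidHom.mem_ker, MonoidHom.mem_range,
    MonoidHom.mem_range]
  constructor
  · rintro ⟨h, y, rfl⟩
    have hy : y ∈ (elemDiv (𝓞 K) K).ker := by
      rw [MonoidHom.mem_ker]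
      apply divRam_injective (L := L)
      apply divPull_injective (L := L)
      rw [map_one, map_one, ← h]
      exact (divPull_divRam_elemDiv y).symm
    rw [ker_elemDiv] at hy
    obtain ⟨u, rfl⟩ := hy
    exact ⟨u, rfl⟩
  · rintro ⟨u, rfl⟩
    refine ⟨?_, _, rfl⟩
    have hu : elemDiv (𝓞 K) K (unitIncl K u) = 1 := by
      rw [← MonoidHom.mem_ker, ker_elemDiv]
      exact ⟨u, rfl⟩
    have := divPull_divRam_elemDiv (L := L) (unitIncl K u)
    rw [hu, map_one, map_one] at this
    exact this

lemma unit_norm_index (h2 : Module.finrank K L = 2) {σ : Gal(L/K)} (hσ : σ ≠ 1) :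
    ((elemDiv (𝓞 L) L).ker ⊓ (nm (Units.map (σ : L →* L))).range).relIndex
      ((elemDiv (𝓞 L) L).ker ⊓ (twist (Units.map (σ : L →* L))).ker) =
      (normUnits K L).index := by
  set g := (Units.map (algebraMap K L : K →* L)).comp (unitIncl K) with hg
  have hginj : Function.Injective g :=
    (Units.map_injective (algebraMap K L).injective).comp (unitIncl_injective K)
  have h1 := ker_elemDiv_inf_ker_twist h2 hσ
  have h3 : (elemDiv (𝓞 L) L).ker ⊓ (nm (Units.map (σ : L →* L))).range =
      (normUnits K L).map g := by
    have hnm : ∀ y : Lˣ, (nm (Units.map (σ : L →* L)) y) =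
        Units.map (algebraMap K L : K →* L) (Units.map (Algebra.norm K : L →* K) y) := fun y ↦ by
      ext
      exact (algebraMap_norm h2 hσ (y : L)).symm
    ext x
    constructor
    · rintro ⟨hx, y, rfl⟩
      have hx' : nm (Units.map (σ : L →* L)) y ∈
          (elemDiv (𝓞 L) L).ker ⊓ (twist (Units.map (σ : L →* L))).ker := by
        refine ⟨hx, ?_⟩
        rw [ker_twist_map h2 hσ]
        exact ⟨_, (hnm y).symm⟩
      rw [h1] at hx'
      obtain ⟨u, hu⟩ := hx'
      refine ⟨u, ⟨y, ?_⟩, hu⟩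
      apply Units.map_injective (algebraMap K L).injective
      rw [hnm] at hu
      exact hu.symm
    · rintro ⟨u, ⟨y, hy⟩, rfl⟩
      have hgu : g u ∈ (elemDiv (𝓞 L) L).ker ⊓ (twist (Units.map (σ : L →* L))).ker := by
        rw [h1]
        exact ⟨u, rfl⟩
      refine ⟨hgu.1, y, ?_⟩
      rw [hnm, hy]
      rfl
  rw [h3, h1, MonoidHom.range_eq_map g, relIndex_map_of_ker_le, Subgroup.relIndex_top_right]
  rw [(MonoidHom.ker_eq_bot_iff g).2 hginj]
  exact bot_le

end UnitIndex

section Chevalley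

open IsDedekindDomain nonZeroDivisors Pointwise

variable {K L : Type*} [Field K] [NumberField K] [Field L] [NumberField L] [Algebra K L]

lemma finrank_inf_ker_nm {G : Type*} [CommGroup G] (σ : G →* G) (hσ : ∀ x, σ (σ x) = x)
    (E : Subgroup G) (hE : ∀ x ∈ E, σ x ∈ E) [Module.Finite ℤ (Additive E)] :
    Module.finrank ℤ (Additive E) =
      Module.finrank ℤ (Additive (E ⊓ (twist σ).ker : Subgroup G)) +
      Module.finrank ℤ (Additive (E ⊓ (nm σ).ker : Subgroup G)) := by
  have h1 : Module.Finite ℤ (Additive (E ⊓ (twist σ).ker : Subgroup G)) :=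
    finite_of_injective (Subgroup.inclusion inf_le_left) (Subgroup.inclusion_injective _)
  let f : E →* (E ⊓ (twist σ).ker : Subgroup G) :=
    ((nm σ).comp E.subtype).codRestrict _ fun x ↦ by
      refine ⟨E.mul_mem x.2 (hE _ x.2), ?_⟩
      refine mem_ker_twist.2 ?_
      simp [hσ, mul_comm]
  have h2 := finrank_eq_add_finrank_ker (MonoidHom.toAdditive f).toIntLinearMap fun y ↦ by
    refine ⟨Additive.ofMul ⟨y.toMul, y.toMul.2.1⟩, ?_⟩
    apply Additive.toMul.injective
    apply Subtype.ext
    have h3 : σ (y.toMul : G) = y.toMul := mem_ker_twist.1 y.toMul.2.2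
    change (y.toMul : G) * σ (y.toMul : G) = ((y.toMul ^ (2 : ℤ) : (E ⊓ (twist σ).ker : Subgroup G)) : G)
    rw [h3, Subgroup.coe_zpow, zpow_ofNat, sq]
  rw [h2]
  congr 1
  let e : f.ker ≃* (E ⊓ (nm σ).ker : Subgroup G) :=
    { toFun x := ⟨x.1.1, x.1.2, congrArg Subtype.val x.2⟩
      invFun x := ⟨⟨x.1, x.2.1⟩, Subtype.ext x.2.2⟩
      left_inv _ := rfl
      right_inv _ := rfl
      map_mul' _ _ := rfl }
  exact (MulEquiv.toAdditive e).toIntLinearEquiv.finrank_eq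

lemma unit_index (h2 : Module.finrank K L = 2) {σ : Gal(L/K)} (hσ : σ ≠ 1) [IsTotallyComplex K] :
    ((elemDiv (𝓞 L) L).ker.map (twist (Units.map (σ : L →* L)))).relIndex
      ((elemDiv (𝓞 L) L).ker ⊓ (nm (Units.map (σ : L →* L))).ker) =
    2 * (normUnits K L).index * ((elemDiv (𝓞 L) L).ker.map (nm (Units.map (σ : L →* L)))).relIndex
      ((elemDiv (𝓞 L) L).ker ⊓ (nm (Units.map (σ : L →* L))).range) ∧
    ((elemDiv (𝓞 L) L).ker.map (nm (Units.map (σ : L →* L)))).relIndex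
      ((elemDiv (𝓞 L) L).ker ⊓ (nm (Units.map (σ : L →* L))).range) ≠ 0 ∧
    (normUnits K L).index ≠ 0 := by
  set E := (elemDiv (𝓞 L) L).ker with hEdef
  set s : Lˣ →* Lˣ := Units.map (σ : L →* L) with hs
  have hss : ∀ x, s (s x) = x := fun x ↦ Units.ext (apply_apply h2 σ (x : L))
  have hE : ∀ x ∈ E, s x ∈ E := fun x hx ↦ by
    rw [hEdef, MonoidHom.mem_ker] at hx ⊢
    rw [hs, divAct_elemDiv h2, hx, map_one]
  have eE : (𝓞 L)ˣ ≃* E :=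
    (MonoidHom.ofInjective (unitIncl_injective L)).trans
      (MulEquiv.subgroupCongr (ker_elemDiv L).symm)
  have eK : (𝓞 K)ˣ ≃* (E ⊓ (twist s).ker : Subgroup Lˣ) :=
    (MonoidHom.ofInjective
      (f := (Units.map (algebraMap K L : K →* L)).comp (unitIncl K))
      ((Units.map_injective (algebraMap K L).injective).comp (unitIncl_injective K))).trans
      (MulEquiv.subgroupCongr (ker_elemDiv_inf_ker_twist h2 hσ).symm)
  have fE : Module.Finite ℤ (Additive E) :=
    finite_of_injective eE.symm.toMonoidHom eE.symm.injective
  have fK : Module.Finite ℤ (Additive (E ⊓ (twist s).ker : Subgroup Lˣ)) :=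
    finite_of_injective (Subgroup.inclusion inf_le_left) (Subgroup.inclusion_injective _)
  have fN : Module.Finite ℤ (Additive (E ⊓ (nm s).ker : Subgroup Lˣ)) :=
    finite_of_injective (Subgroup.inclusion inf_le_left) (Subgroup.inclusion_injective _)
  have hr := finrank_inf_ker_nm s hss E hE
  rw [← finrank_of_mulEquiv eE, ← finrank_of_mulEquiv eK, NumberField.Units.finrank_eq,
    NumberField.Units.finrank_eq, rank_eq h2] at hr
  have hneg : (-1 : Lˣ) ∈ E := by
    rw [hEdef, ker_elemDiv]
    exact ⟨-1, by ext; simp [unitIncl]⟩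
  have hneg1 : s (-1) = -1 := by ext; simp [hs]
  have ht1 : (-1 : Lˣ) ∈ E ⊓ (twist s).ker := ⟨hneg, mem_ker_twist.2 hneg1⟩
  have ht2 : (-1 : Lˣ) ∈ E ⊓ (nm s).ker :=
    ⟨hneg, MonoidHom.mem_ker.2 (by rw [nm_apply, hneg1, neg_one_mul, neg_neg])⟩
  have hh := herbrand_index s hss E hE
  rw [relIndex_squares, relIndex_squares, card_two_torsion _ ht2,
    card_two_torsion _ ht1, ← finrank_of_mulEquiv eK,
    NumberField.Units.finrank_eq] at hh
  have hle1 : E.map (nm s) ≤ E ⊓ (nm s).range := by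
    rintro _ ⟨x, hx, rfl⟩
    exact ⟨E.mul_mem hx (hE _ hx), x, rfl⟩
  have hle2 : E ⊓ (nm s).range ≤ E ⊓ (twist s).ker := by
    rintro _ ⟨hx, x, rfl⟩
    refine ⟨hx, ?_⟩
    refine mem_ker_twist.2 ?_
    simp [hss, mul_comm]
  have hmul := Subgroup.relIndex_mul_relIndex _ _ _ hle1 hle2
  rw [unit_norm_index h2 hσ] at hmul
  have hne : (E.map (nm s)).relIndex (E ⊓ (twist s).ker) ≠ 0 := by
    have h3 : ((E ⊓ (twist s).ker).map (powMonoidHom 2)).relIndex (E ⊓ (twist s).ker) ≠ 0 := by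
      rw [relIndex_squares, card_two_torsion _ ht1]
      positivity
    refine ne_zero_of_dvd_ne_zero h3 (Subgroup.relIndex_dvd_of_le_left _ ?_)
    rintro _ ⟨x, hx, rfl⟩
    refine ⟨x, hx.1, ?_⟩
    rw [nm_apply, mem_ker_twist.1 hx.2, powMonoidHom_apply, sq]
  rw [← hmul] at hh hne
  refine ⟨?_, left_ne_zero_of_mul hne, right_ne_zero_of_mul hne⟩
  have hr' : Module.finrank ℤ (Additive (E ⊓ (nm s).ker : Subgroup Lˣ)) = Units.rank K + 1 := by
    omega
  rw [hr', pow_succ] at hh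
  have : (0 : ℕ) < 2 ^ Units.rank K := by positivity
  nlinarith

theorem chevalley (h2 : Module.finrank K L = 2) {σ : Gal(L/K)} (hσ : σ ≠ 1) [IsTotallyComplex K]
    (hT : (ramSet K L).Finite) :
    (elemDiv (𝓞 L) L).range.relIndex ((elemDiv (𝓞 L) L).range.comap (twist (divAct h2 σ))) *
      (2 * (normUnits K L).index) =
    Nat.card (ClassGroup (𝓞 K)) * 2 ^ (ramSet K L).ncard := by
  have h := chevalley_index (Units.map (σ : L →* L)) (divAct h2 σ) (elemDiv (𝓞 L) L)
    (fun x ↦ Units.ext (apply_apply h2 σ (x : L))) (divAct_divAct h2 σ)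
    (divAct_elemDiv h2 σ) ?_ ?_
  · obtain ⟨h3, h4, h5⟩ := unit_index h2 hσ
    rw [h3, relIndex_invariant_divisors h2 hσ hT] at h
    apply Nat.eq_of_mul_eq_mul_right (Nat.pos_of_ne_zero h4)
    rw [← h]
    ring
  · intro x hx
    obtain ⟨y, hy, hxy⟩ := exists_eq_div h2 hσ (congrArg Units.val hx)
    exact ⟨Units.mk0 y hy, Units.ext (by simpa using hxy)⟩
  · exact fun x hx ↦ exists_eq_div_divAct h2 hσ hx

end Chevalley

section AmbiguousFormula

open IsDedekindDomain nonZeroDivisors Pointwise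

lemma two_pow_eq_of_odd {m h a b : ℕ} (hm : Odd m) (hh : Odd h) (e : 2 ^ a * m = h * 2 ^ b) :
    2 ^ a = 2 ^ b := by
  have h1 : (2 ^ a).Coprime h := (Nat.coprime_two_left.2 hh).pow_left a
  have h2 : (2 ^ b).Coprime m := (Nat.coprime_two_left.2 hm).pow_left b
  exact Nat.dvd_antisymm (h1.dvd_of_dvd_mul_left (e ▸ dvd_mul_right _ _))
    (h2.dvd_of_dvd_mul_right (e ▸ dvd_mul_left _ _))

lemma exists_card_eq_two_pow {G : Type*} [CommGroup G] [Finite G] (h : ∀ x : G, x ^ 2 = 1) :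
    ∃ b, Nat.card G = 2 ^ b :=
  have : Fact (Nat.Prime 2) := ⟨Nat.prime_two⟩
  IsPGroup.iff_card.1 fun x ↦ ⟨1, by rw [pow_one, h]⟩

lemma index_squares_mul {C : Type*} [CommGroup C] [Finite C] (A : Subgroup C) {h a t : ℕ}
    (hh : Odd h) (h1 : ∀ c : C, c ^ 2 = 1 → c ∈ A) (h2 : ∀ c ∈ A, c ^ (2 * h) = 1)
    (hc : Nat.card A * 2 ^ a = h * 2 ^ t) :
    (powMonoidHom 2 : C →* C).range.index * 2 ^ a = 2 ^ t := by
  let f : A →* A := powMonoidHom 2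
  have hf : Nat.card f.range * Nat.card f.ker = Nat.card A := by
    rw [← Subgroup.index_ker, mul_comm, Subgroup.card_mul_index]
  have hk : Nat.card (powMonoidHom 2 : C →* C).ker = Nat.card f.ker := by
    refine Nat.card_congr ⟨fun x ↦ ⟨⟨x, h1 _ x.2⟩, Subtype.ext x.2⟩,
      fun x ↦ ⟨x.1.1, congrArg Subtype.val x.2⟩, fun _ ↦ rfl, fun _ ↦ rfl⟩
  have hodd : Odd (Nat.card f.range) := by
    rw [← Nat.not_even_iff_odd, even_iff_two_dvd]
    intro hd
    have : Fact (Nat.Prime 2) := ⟨Nat.prime_two⟩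
    obtain ⟨⟨_, x, rfl⟩, hx⟩ := exists_prime_orderOf_dvd_card' 2 hd
    have h3 : (⟨f x, x, rfl⟩ : f.range) ^ h = 1 := by
      apply Subtype.ext
      apply Subtype.ext
      have := h2 x x.2
      rwa [pow_mul] at this
    have h4 := orderOf_dvd_of_pow_eq_one h3
    rw [hx] at h4
    exact (Nat.not_even_iff_odd.2 hh) (even_iff_two_dvd.2 h4)
  obtain ⟨b, hb⟩ := exists_card_eq_two_pow (G := f.ker) fun x ↦ Subtype.ext x.2
  rw [Subgroup.index_range, hk, hb, ← pow_add]
  refine two_pow_eq_of_odd hodd hh ?_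
  rw [← hc, ← hf, hb, pow_add]
  ring

variable {K L : Type*} [Field K] [NumberField K] [Field L] [NumberField L] [Algebra K L]

/-- The class group as a quotient of the group of divisors. -/
noncomputable def classGroupEquiv (F : Type*) [Field F] [NumberField F] :
    ClassGroup (𝓞 F) ≃* DivGroup (𝓞 F) ⧸ (elemDiv (𝓞 F) F).range :=
  (ClassGroup.equiv F).trans (QuotientGroup.congr _ _
    (MulEquiv.ofBijective (idealDiv (𝓞 F) F) (idealDiv_bijective (𝓞 F) F))
    (by rw [elemDiv, MonoidHom.range_comp]; rfl))

lemma pow_classNumber_mem (F : Type*) [Field F] [NumberField F] (D : DivGroup (𝓞 F)) :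
    D ^ Nat.card (ClassGroup (𝓞 F)) ∈ (elemDiv (𝓞 F) F).range := by
  rw [← index_range_elemDiv (𝓞 F) F]
  exact Subgroup.pow_index_mem _ D

lemma mul_divAct_pow_mem (h2 : Module.finrank K L = 2) {σ : Gal(L/K)} (hσ : σ ≠ 1)
    (D : DivGroup (𝓞 L)) :
    (D * divAct h2 σ D) ^ Nat.card (ClassGroup (𝓞 K)) ∈ (elemDiv (𝓞 L) L).range := by
  have := isGalois_of_finrank h2
  have h1 : D * divAct h2 σ D ∈ (divPull K L).range := by
    rw [range_divPull h2 hσ, mem_ker_twist]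
    rw [map_mul, divAct_divAct, mul_comm]
  obtain ⟨X, hX⟩ := h1
  have h3 : X ∈ (divRam K L).range := by
    rw [range_divRam h2]
    refine (mem_ker_modTwo (D := X.toAdd)).2 fun P hP ↦ ?_
    have h4 := ramIdx_eq_two h2 hP
    rw [← primeAbove_under (L := L) P] at h4 ⊢
    rw [← divPull_apply, hX, toAdd_mul, Finsupp.add_apply, divAct_apply, smulPrime_eq _ (h4.trans h2.symm)]
    exact ⟨_, (two_mul _).symm⟩
  obtain ⟨Y, rfl⟩ := h3
  obtain ⟨y, hy⟩ := pow_classNumber_mem K Y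
  refine ⟨Units.map (algebraMap K L) y, ?_⟩
  rw [divPull_divRam_elemDiv, hy, map_pow, map_pow, hX]

lemma sq_mem_normUnits (h2 : Module.finrank K L = 2) (u : (𝓞 K)ˣ) : u ^ 2 ∈ normUnits K L := by
  rw [mem_normUnits]
  refine ⟨algebraMap K L (algebraMap (𝓞 K) K u), ?_⟩
  rw [Algebra.norm_algebraMap, h2, Units.val_pow_eq_pow_val, map_pow]

lemma exists_index_normUnits_eq (h2 : Module.finrank K L = 2) (h : (normUnits K L).index ≠ 0) :
    ∃ b, (normUnits K L).index = 2 ^ b := by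
  have : Finite ((𝓞 K)ˣ ⧸ normUnits K L) := by
    have : (normUnits K L).FiniteIndex := ⟨h⟩
    infer_instance
  refine exists_card_eq_two_pow fun x ↦ ?_
  obtain ⟨u, rfl⟩ := QuotientGroup.mk_surjective x
  rw [← QuotientGroup.mk_pow, QuotientGroup.eq_one_iff]
  exact sq_mem_normUnits h2 u

theorem index_squares_classGroup (h2 : Module.finrank K L = 2) [IsTotallyComplex K]
    (hT : (ramSet K L).Finite) (hodd : Odd (Nat.card (ClassGroup (𝓞 K)))) :
    (powMonoidHom 2 : ClassGroup (𝓞 L) →* ClassGroup (𝓞 L)).range.index *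
      (2 * (normUnits K L).index) = 2 ^ (ramSet K L).ncard := by
  have := isGalois_of_finrank h2
  obtain ⟨σ, hσ⟩ : ∃ σ : Gal(L/K), σ ≠ 1 := by
    have hc : Nat.card Gal(L/K) = 2 := by rw [IsGalois.card_aut_eq_finrank, h2]
    have : Nontrivial Gal(L/K) := Finite.one_lt_card_iff_nontrivial.1 (by omega)
    exact exists_ne 1
  have hch := chevalley h2 hσ hT
  obtain ⟨b, hb⟩ := exists_index_normUnits_eq h2 (unit_index h2 hσ).2.2
  rw [hb, ← pow_succ'] at hch ⊢
  set P := (elemDiv (𝓞 L) L).range with hP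
  have e := classGroupEquiv L
  have hfin : Finite (DivGroup (𝓞 L) ⧸ P) := Finite.of_equiv _ e.toEquiv
  set A : Subgroup (DivGroup (𝓞 L) ⧸ P) :=
    (P.comap (twist (divAct h2 σ))).map (QuotientGroup.mk' P) with hA
  have hPM : P ≤ P.comap (twist (divAct h2 σ)) := by
    rintro _ ⟨x, rfl⟩
    refine P.div_mem ⟨x, rfl⟩ ⟨Units.map (σ : L →* L) x, ?_⟩
    exact divAct_elemDiv h2 σ x
  have hAmem : ∀ D : DivGroup (𝓞 L), (D : DivGroup (𝓞 L) ⧸ P) ∈ A ↔ D / divAct h2 σ D ∈ P := by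
    intro D
    have h3 : (D : DivGroup (𝓞 L) ⧸ P) ∈ A ↔ D ∈ A.comap (QuotientGroup.mk' P) := Iff.rfl
    rw [h3, hA, Subgroup.comap_map_eq_self]
    · rfl
    · rwa [QuotientGroup.ker_mk']
  have hcard : Nat.card A = P.relIndex (P.comap (twist (divAct h2 σ))) := by
    rw [← Subgroup.relIndex_bot_left]
    rw [← relIndex_map_of_ker_le (QuotientGroup.mk' P) (by rw [QuotientGroup.ker_mk'])]
    congr 1
    rw [eq_comm, Subgroup.map_eq_bot_iff, QuotientGroup.ker_mk']
  have hτ : ∀ x ∈ P, divAct h2 σ x ∈ P := by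
    rintro _ ⟨x, rfl⟩
    exact ⟨Units.map (σ : L →* L) x, divAct_elemDiv h2 σ x⟩
  have key := index_squares_mul A hodd ?_ ?_ (by rw [hcard]; exact hch)
  · rw [← key]
    congr 1
    refine Nat.card_congr (QuotientGroup.congr _ _ e ?_).toEquiv
    ext x
    constructor
    · rintro ⟨_, ⟨y, rfl⟩, rfl⟩
      exact ⟨e y, (map_pow e y 2).symm⟩
    · rintro ⟨y, rfl⟩
      exact ⟨e.symm y ^ 2, ⟨_, rfl⟩, by simp⟩
  · intro c hc
    obtain ⟨D, rfl⟩ := QuotientGroup.mk_surjective c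
    rw [← QuotientGroup.mk_pow, QuotientGroup.eq_one_iff] at hc
    rw [hAmem]
    have h3 : (D * divAct h2 σ D) ^ 2 ∈ P := by
      rw [mul_pow, ← map_pow]
      exact P.mul_mem hc (hτ _ hc)
    have h4 := mul_divAct_pow_mem h2 hσ D
    obtain ⟨k, hk⟩ := hodd
    rw [hk, pow_succ, pow_mul] at h4
    have h5 := (P.mul_mem_cancel_left (P.pow_mem h3 k)).1 h4
    have h6 : D / divAct h2 σ D = D ^ 2 / (D * divAct h2 σ D) := by
      rw [sq, mul_div_mul_left_eq_div]
    rw [h6]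
    exact P.div_mem hc h5
  · intro c hc
    obtain ⟨D, rfl⟩ := QuotientGroup.mk_surjective c
    rw [hAmem] at hc
    rw [← QuotientGroup.mk_pow, QuotientGroup.eq_one_iff]
    have h6 : D ^ 2 = (D / divAct h2 σ D) * (D * divAct h2 σ D) := by
      rw [div_mul_mul_cancel, sq]
    rw [pow_mul, h6, mul_pow]
    exact P.mul_mem (P.pow_mem hc _) (mul_divAct_pow_mem h2 hσ D)

end AmbiguousFormula

section Symbol

open IsDedekindDomain nonZeroDivisors Pointwise

variable {K L : Type*} [Field K] [NumberField K] [Field L] [NumberField L] [Algebra K L]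

lemma exists_ne_one (h2 : Module.finrank K L = 2) : ∃ σ : Gal(L/K), σ ≠ 1 := by
  have := isGalois_of_finrank h2
  have hc : Nat.card Gal(L/K) = 2 := by rw [IsGalois.card_aut_eq_finrank, h2]
  have : Nontrivial Gal(L/K) := Finite.one_lt_card_iff_nontrivial.1 (by omega)
  exact exists_ne 1

lemma apply_sqrt (h2 : Module.finrank K L = 2) {σ : Gal(L/K)} (hσ : σ ≠ 1) {s : L} {a : K}
    (hs : s ^ 2 = algebraMap K L a) (hsK : s ∉ Set.range (algebraMap K L)) : σ s = -s := by
  have h : σ s ^ 2 = s ^ 2 := by rw [← map_pow, hs, AlgEquiv.commutes]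
  rcases sq_eq_sq_iff_eq_or_eq_neg.1 h with h | h
  · obtain ⟨y, hy⟩ := exists_algebraMap_eq h2 hσ h
    exact absurd ⟨y, hy⟩ hsK
  · exact h

lemma mem_ramSet_of_odd (h2 : Module.finrank K L = 2) {s : Lˣ} {a : Kˣ}
    (hs : (s : L) ^ 2 = algebraMap K L a) (P : HeightOneSpectrum (𝓞 K))
    (hP : Odd ((elemDiv (𝓞 K) K a).toAdd P)) : P ∈ ramSet K L := by
  have := isGalois_of_finrank h2
  intro h
  have h1 := elemDiv_algebraMap (L := L) (primeAbove L P) a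
  have h3 : Units.map (algebraMap K L : K →* L) a = s ^ 2 := Units.ext hs.symm
  rw [h3, map_pow, toAdd_pow, primeAbove_under, h, Nat.cast_one, one_mul] at h1
  rw [← h1, Finsupp.smul_apply, nsmul_eq_mul] at hP
  exact (Int.not_even_iff_odd.2 hP) (by simp)

lemma mem_under_iff {P : HeightOneSpectrum (𝓞 K)} {x : 𝓞 K} :
    algebraMap (𝓞 K) (𝓞 L) x ∈ (primeAbove L P).asIdeal ↔ x ∈ P.asIdeal := by
  conv_rhs => rw [← primeAbove_under (L := L) P]
  rfl

lemma sub_mem_of_mem_ramSet (h2 : Module.finrank K L = 2) {P : HeightOneSpectrum (𝓞 K)}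
    (hP : P ∈ ramSet K L) (σ : Gal(L/K)) (x : 𝓞 L) :
    σ • x - x ∈ (primeAbove L P).asIdeal := by
  have := isGalois_of_finrank h2
  refine smul_sub_mem _ ?_ σ x
  rw [primeAbove_under, ramIdx_eq_two h2 hP, h2]

lemma sub_sq_mem {P : HeightOneSpectrum (𝓞 K)} (h2 : Module.finrank K L = 2)
    (hP : P ∈ ramSet K L) (σ : Gal(L/K)) {x : L} (hx : IsIntegral (𝓞 K) x) {c : 𝓞 K}
    (hc : (σ x - x) ^ 2 = algebraMap (𝓞 K) L c) : c ∈ P.asIdeal := by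
  have hsint : IsIntegral ℤ x := isIntegral_trans _ hx
  obtain ⟨y, hy⟩ : ∃ y : 𝓞 L, (y : L) = x := ⟨⟨x, hsint⟩, rfl⟩
  rw [← mem_under_iff (L := L)]
  have h3 := Ideal.mul_mem_left _ (σ • y - y) (sub_mem_of_mem_ramSet h2 hP σ y)
  convert h3 using 1
  apply RingOfIntegers.ext
  have h4 : ((σ • y : 𝓞 L) : L) = σ y := rfl
  have h5 : ((algebraMap (𝓞 K) (𝓞 L) c : 𝓞 L) : L) = algebraMap (𝓞 K) L c := rfl
  have h6 : (((σ • y - y) * (σ • y - y) : 𝓞 L) : L) = (σ y - y) * (σ y - y) := rfl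
  rw [h5, ← hc, h6, hy, sq]

/-- If `s ^ 2 = a`, the ramified primes divide `4 * a`. -/
lemma four_mul_mem (h2 : Module.finrank K L = 2) {s : L} {a : 𝓞 K}
    (hs : s ^ 2 = algebraMap (𝓞 K) L a) (hsK : s ∉ Set.range (algebraMap K L))
    {P : HeightOneSpectrum (𝓞 K)} (hP : P ∈ ramSet K L) : 4 * a ∈ P.asIdeal := by
  obtain ⟨σ, hσ⟩ := exists_ne_one h2
  have hsint : IsIntegral (𝓞 K) s := by
    refine IsIntegral.of_pow two_pos ?_
    rw [hs]
    exact isIntegral_algebraMap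
  refine sub_sq_mem h2 hP σ hsint ?_
  rw [apply_sqrt h2 hσ (a := algebraMap (𝓞 K) K a) hs hsK, map_mul, ← hs, map_ofNat]
  ring

/-- If `s ^ 2 = a` with `a ≡ 1` modulo `4`, the ramified primes divide `a`. -/
lemma mem_of_one_mod_four (h2 : Module.finrank K L = 2) {s : L} {a b : 𝓞 K} (hab : a = 4 * b + 1)
    (hs : s ^ 2 = algebraMap (𝓞 K) L a) (hsK : s ∉ Set.range (algebraMap K L))
    {P : HeightOneSpectrum (𝓞 K)} (hP : P ∈ ramSet K L) : a ∈ P.asIdeal := by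
  obtain ⟨σ, hσ⟩ := exists_ne_one h2
  have hsint : IsIntegral (𝓞 K) ((1 + s) / 2) := by
    refine ⟨Polynomial.X ^ 2 - Polynomial.X - Polynomial.C b, by monicity!, ?_⟩
    simp only [Polynomial.eval₂_sub, Polynomial.eval₂_pow, Polynomial.eval₂_X, Polynomial.eval₂_C]
    rw [hab, map_add, map_mul, map_ofNat, map_one] at hs
    linear_combination hs / 4
  refine sub_sq_mem h2 hP σ hsint ?_
  rw [map_div₀, map_add, map_one, map_ofNat,
    apply_sqrt h2 hσ (a := algebraMap (𝓞 K) K a) hs hsK, ← hs]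
  ring

/-- A unit which is a norm is a square modulo every ramified prime. -/
lemma exists_sq_sub_mem (h2 : Module.finrank K L = 2) {P : HeightOneSpectrum (𝓞 K)}
    (hP : P ∈ ramSet K L) {u : (𝓞 K)ˣ} (hu : u ∈ normUnits K L) :
    ∃ w : 𝓞 K, w ^ 2 - u ∈ P.asIdeal := by
  have := isGalois_of_finrank h2
  obtain ⟨σ, hσ⟩ := exists_ne_one h2
  obtain ⟨y, hy⟩ := mem_normUnits.1 hu
  set v := primeAbove L P with hv
  have hram : ramIdx L (v.under (𝓞 K)) = Module.finrank K L := by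
    rw [hv, primeAbove_under, ramIdx_eq_two h2 hP, h2]
  have hvσ : ∀ x : L, v.valuation L (σ x) = v.valuation L x := fun x ↦ by
    have := valuation_smulPrime σ v x
    rwa [smulPrime_eq v hram] at this
  have hyy : y * σ y = algebraMap (𝓞 L) L (algebraMap (𝓞 K) (𝓞 L) u) := by
    rw [← algebraMap_norm h2 hσ, hy]
    rfl
  have hu1 : v.valuation L (y * σ y) = 1 := by
    rw [hyy, HeightOneSpectrum.valuation_eq_one_iff_notMem]
    exact fun h ↦ v.isPrime.ne_top (Ideal.eq_top_of_isUnit_mem _ h (u.isUnit.map _))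
  rw [map_mul, hvσ, ← sq, pow_eq_one_iff, or_iff_left two_ne_zero] at hu1
  obtain ⟨a, ha⟩ := HeightOneSpectrum.exists_valuation_sub_lt_of_integer v (x := y) hu1.le 1
  obtain ⟨b, hb⟩ := exists_sub_algebraMap_mem v hram a
  have hsint : ∀ x : 𝓞 L, v.valuation L (algebraMap (𝓞 L) L x) ≤ 1 := v.valuation_le_one
  have hlt : ∀ {x : L} {z : L}, v.valuation L x < 1 → v.valuation L z ≤ 1 →
      v.valuation L (x * z) < 1 := fun h h' ↦ by
    rw [map_mul]
    exact mul_lt_one_of_lt_of_le h h'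
  have hadd : ∀ {x : L} {z : L}, v.valuation L x < 1 → v.valuation L z < 1 →
      v.valuation L (x + z) < 1 := fun h h' ↦ Valuation.map_add_lt _ h h'
  have h1 : v.valuation L (algebraMap (𝓞 L) L (a - algebraMap (𝓞 K) (𝓞 L) b)) < 1 :=
    (v.valuation_lt_one_iff_mem _).2 hb
  have h3 : v.valuation L (algebraMap (𝓞 L) L (σ • a - a)) < 1 :=
    (v.valuation_lt_one_iff_mem _).2 (smul_sub_mem v hram σ a)
  have ha' : v.valuation L (algebraMap (𝓞 L) L a - y) < 1 := by simpa using ha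
  have h4 : v.valuation L (σ (algebraMap (𝓞 L) L a - y)) < 1 := by rwa [hvσ]
  refine ⟨b, ?_⟩
  rw [← mem_under_iff (L := L), ← hv]
  refine (v.valuation_lt_one_iff_mem (K := L) _).1 ?_
  have e : algebraMap (𝓞 L) L (algebraMap (𝓞 K) (𝓞 L) (b ^ 2 - u)) =
      (algebraMap (𝓞 L) L (a - algebraMap (𝓞 K) (𝓞 L) b)) *
        algebraMap (𝓞 L) L (-(a + algebraMap (𝓞 K) (𝓞 L) b)) +
      algebraMap (𝓞 L) L (σ • a - a) * algebraMap (𝓞 L) L (-a) +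
      σ (algebraMap (𝓞 L) L a - y) * algebraMap (𝓞 L) L a +
      (algebraMap (𝓞 L) L a - y) * σ y := by
    have h5 : algebraMap (𝓞 L) L (σ • a) = σ (algebraMap (𝓞 L) L a) := rfl
    simp only [map_sub, map_pow, map_add, map_neg, h5, ← hyy]
    ring
  refine (congrArg (v.valuation L) e).trans_lt ?_
  exact hadd (hadd (hadd (hlt h1 (hsint _)) (hlt h3 (hsint _))) (hlt h4 (hsint _)))
    (hlt ha' (by rw [hvσ, hu1]))

end Symbol

section NormForm

variable {K : Type*} [Field K]

/-- `u` is represented by the norm form `X ^ 2 - a * Y ^ 2`. -/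
def IsNormForm (u a : K) : Prop := ∃ x y : K, x ^ 2 - a * y ^ 2 = u

lemma isNormForm_sq [NeZero (2 : K)] (u : K) {b : K} (hb : b ≠ 0) : IsNormForm u (b ^ 2) := by
  have h2 : (2 : K) ≠ 0 := NeZero.ne _
  refine ⟨(u + 1) / 2, (u - 1) / (2 * b), ?_⟩
  field_simp
  ring

lemma IsNormForm.mul_left {u v a : K} (hu : IsNormForm u a) (hv : IsNormForm v a) :
    IsNormForm (u * v) a := by
  obtain ⟨x, y, rfl⟩ := hu
  obtain ⟨z, w, rfl⟩ := hv
  exact ⟨x * z + a * y * w, x * w + y * z, by ring⟩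

lemma IsNormForm.symm [NeZero (2 : K)] {u a : K} (hu0 : u ≠ 0) (hu : IsNormForm u a) :
    IsNormForm a u := by
  obtain ⟨x, y, h⟩ := hu
  by_cases hy : y = 0
  · subst hy
    have hx : u = x ^ 2 := by linear_combination -h
    have hx0 : x ≠ 0 := by
      rintro rfl
      exact hu0 (by linear_combination hx)
    rw [hx]
    exact isNormForm_sq a hx0
  · refine ⟨x / y, 1 / y, ?_⟩
    field_simp
    linear_combination h

lemma IsNormForm.inv_right {u a : K} (h : IsNormForm u a) : IsNormForm u a⁻¹ := by
  obtain ⟨x, y, h⟩ := h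
  refine ⟨x, a * y, ?_⟩
  field_simp
  linear_combination h

/-- The elements `a` such that `u` is represented by `X ^ 2 - a * Y ^ 2`. -/
def normFormGroup [NeZero (2 : K)] (u : Kˣ) : Subgroup Kˣ where
  carrier := {a | IsNormForm (u : K) (a : K)}
  one_mem' := by simpa using isNormForm_sq (u : K) one_ne_zero
  mul_mem' {a b} ha hb := by
    have h1 := (IsNormForm.symm u.ne_zero ha).mul_left (IsNormForm.symm u.ne_zero hb)
    exact IsNormForm.symm (a * b).ne_zero h1
  inv_mem' {a} ha := by
    have := IsNormForm.inv_right ha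
    simpa using this

lemma mem_normFormGroup [NeZero (2 : K)] {u a : Kˣ} :
    a ∈ normFormGroup u ↔ IsNormForm (u : K) (a : K) := Iff.rfl

lemma mem_normFormGroup_of_pow [NeZero (2 : K)] {u a : Kˣ} {h : ℕ} (hh : Odd h)
    (ha : a ^ h ∈ normFormGroup u) : a ∈ normFormGroup u := by
  obtain ⟨k, rfl⟩ := hh
  have h1 : a ^ (2 * k) ∈ normFormGroup u := by
    rw [mem_normFormGroup, mul_comm, pow_mul, Units.val_pow_eq_pow_val]
    exact isNormForm_sq _ (Units.ne_zero _)
  rw [pow_succ] at ha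
  exact ((normFormGroup u).mul_mem_cancel_left h1).1 ha

end NormForm

section QuadraticExtension

universe u

variable {K : Type u} [Field K] [NumberField K]

lemma exists_quadratic {a : K} (ha : ¬ IsSquare a) :
    ∃ (M : Type u) (_ : Field M) (_ : NumberField M) (_ : Algebra K M) (s : M),
      Module.finrank K M = 2 ∧ s ^ 2 = algebraMap K M a ∧ s ∉ Set.range (algebraMap K M) := by
  obtain ⟨s, hs⟩ := IsAlgClosed.exists_pow_nat_eq (algebraMap K (AlgebraicClosure K) a) two_pos
  have hirr : Irreducible (Polynomial.X ^ 2 - Polynomial.C a) := by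
    refine X_pow_sub_C_irreducible_of_prime Nat.prime_two fun b hb ↦ ha ⟨b, ?_⟩
    rw [← hb, sq]
  have hmin : Polynomial.X ^ 2 - Polynomial.C a = minpoly K s := by
    refine minpoly.eq_of_irreducible_of_monic hirr (by simp [hs]) ?_
    exact Polynomial.monic_X_pow_sub_C a two_ne_zero
  have hsint : IsIntegral K s := Algebra.IsIntegral.isIntegral s
  have hfin : FiniteDimensional K K⟮s⟯ := adjoin.finiteDimensional hsint
  have hdeg : Module.finrank K K⟮s⟯ = 2 := by
    rw [adjoin.finrank hsint, ← hmin, Polynomial.natDegree_X_pow_sub_C]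
  have hnf : NumberField K⟮s⟯ := by
    have : FiniteDimensional ℚ K⟮s⟯ := Module.Finite.trans K _
    exact { to_charZero := charZero_of_injective_algebraMap (algebraMap K _).injective }
  refine ⟨K⟮s⟯, inferInstance, hnf, inferInstance, AdjoinSimple.gen K s, hdeg, ?_, ?_⟩
  · apply Subtype.ext
    exact hs
  · rintro ⟨b, hb⟩
    refine ha ⟨b, ?_⟩
    apply (algebraMap K (AlgebraicClosure K)).injective
    rw [← hs, map_mul, ← sq]
    congr 1
    exact (congrArg Subtype.val hb).symm

variable {M : Type*} [Field M] [NumberField M] [Algebra K M]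

lemma isNormForm_iff (h2 : Module.finrank K M = 2) {s : M} {a u : K}
    (hs : s ^ 2 = algebraMap K M a) (hsK : s ∉ Set.range (algebraMap K M)) :
    IsNormForm u a ↔ ∃ y : M, Algebra.norm K y = u := by
  obtain ⟨σ, hσ⟩ := exists_ne_one h2
  have hσs := apply_sqrt h2 hσ hs hsK
  have hs0 : s ≠ 0 := fun h ↦ hsK ⟨0, by rw [h, map_zero]⟩
  constructor
  · rintro ⟨x, y, rfl⟩
    refine ⟨algebraMap K M x + algebraMap K M y * s, ?_⟩
    apply (algebraMap K M).injective
    rw [algebraMap_norm h2 hσ, map_add, map_mul, hσs, AlgEquiv.commutes, AlgEquiv.commutes,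
      map_sub, map_mul, ← hs, map_pow, map_pow]
    ring
  · rintro ⟨z, rfl⟩
    obtain ⟨x, hx⟩ := exists_algebraMap_eq h2 hσ (x := (z + σ z) / 2) (by
      rw [map_div₀, map_add, apply_apply h2, map_ofNat, add_comm])
    obtain ⟨y, hy⟩ := exists_algebraMap_eq h2 hσ (x := (z - σ z) / (2 * s)) (by
      rw [map_div₀, map_sub, apply_apply h2, map_mul, map_ofNat, hσs]
      field_simp
      ring)
    refine ⟨x, y, (algebraMap K M).injective ?_⟩
    rw [algebraMap_norm h2 hσ, map_sub, map_mul, map_pow, map_pow, hx, hy, ← hs]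
    field_simp
    ring

end QuadraticExtension

section OddClassNumber

open IsDedekindDomain nonZeroDivisors Pointwise

universe u

variable {K : Type u} [Field K] [NumberField K] [IsTotallyComplex K]
variable {L : Type*} [Field L] [NumberField L] [Algebra K L]

lemma two_mul_index_dvd (h2 : Module.finrank K L = 2)
    (hodd : Odd (Nat.card (ClassGroup (𝓞 K)))) {T : Set (HeightOneSpectrum (𝓞 K))}
    (hT : T.Finite) (h : ramSet K L ⊆ T) :
    (powMonoidHom 2 : ClassGroup (𝓞 L) →* ClassGroup (𝓞 L)).range.index *
      (2 * (normUnits K L).index) ∣ 2 ^ T.ncard := by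
  rw [index_squares_classGroup h2 (hT.subset h) hodd]
  exact pow_dvd_pow 2 (Set.ncard_le_ncard h hT)

lemma normUnits_eq_top (h2 : Module.finrank K L = 2)
    (hodd : Odd (Nat.card (ClassGroup (𝓞 K)))) {T : Set (HeightOneSpectrum (𝓞 K))}
    (hT : T.Subsingleton) (h : ramSet K L ⊆ T) : normUnits K L = ⊤ := by
  have h1 := two_mul_index_dvd h2 hodd hT.finite h
  have h3 : T.ncard ≤ 1 := (Set.ncard_le_one hT.finite).2 fun a ha b hb ↦ hT ha hb
  have h4 := (dvd_of_mul_left_dvd h1).trans (pow_dvd_pow 2 h3)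
  rw [pow_one] at h4
  rw [← Subgroup.index_eq_one]
  exact Nat.dvd_one.1 (Nat.dvd_of_mul_dvd_mul_left two_pos (by simpa using h4))

lemma odd_card_classGroup (h2 : Module.finrank K L = 2)
    (hodd : Odd (Nat.card (ClassGroup (𝓞 K)))) {T : Set (HeightOneSpectrum (𝓞 K))}
    (hT : T.Subsingleton) (h : ramSet K L ⊆ T) : Odd (Nat.card (ClassGroup (𝓞 L))) := by
  have h1 := two_mul_index_dvd h2 hodd hT.finite h
  have h3 : T.ncard ≤ 1 := (Set.ncard_le_one hT.finite).2 fun a ha b hb ↦ hT ha hb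
  have h4 := h1.trans (pow_dvd_pow 2 h3)
  have h5 : (powMonoidHom 2 : ClassGroup (𝓞 L) →* ClassGroup (𝓞 L)).range = ⊤ := by
    rw [← Subgroup.index_eq_one]
    have h6 : 2 * (powMonoidHom 2 : ClassGroup (𝓞 L) →* ClassGroup (𝓞 L)).range.index ∣ 2 * 1 := by
      rw [mul_left_comm, pow_one] at h4
      exact (mul_dvd_mul_left 2 (dvd_mul_right _ _)).trans h4
    exact Nat.dvd_one.1 (Nat.dvd_of_mul_dvd_mul_left two_pos h6)
  have h7 := Finite.injective_iff_surjective.2 (MonoidHom.range_eq_top.1 h5)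
  rw [← Nat.not_even_iff_odd, even_iff_two_dvd]
  intro hd
  have : Fact (Nat.Prime 2) := ⟨Nat.prime_two⟩
  obtain ⟨c, hc⟩ := exists_prime_orderOf_dvd_card' 2 hd
  have h8 : c ^ 2 = 1 ^ 2 := by rw [← hc, pow_orderOf_eq_one, one_pow]
  rw [h7 h8, orderOf_one] at hc
  omega

/-- The primes containing `2`. -/
def primesAboveTwo (K : Type*) [Field K] : Set (HeightOneSpectrum (𝓞 K)) :=
  {P | (2 : 𝓞 K) ∈ P.asIdeal}

lemma ramSet_subset_primesAboveTwo (h2 : Module.finrank K L = 2) (v : (𝓞 K)ˣ) {s : L}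
    (hs : s ^ 2 = algebraMap K L (algebraMap (𝓞 K) K v)) (hsK : s ∉ Set.range (algebraMap K L)) :
    ramSet K L ⊆ primesAboveTwo K := by
  intro P hP
  have h4 := four_mul_mem h2 (a := (v : 𝓞 K)) hs hsK hP
  rcases P.isPrime.mem_or_mem h4 with h5 | h5
  · have h6 : (2 : 𝓞 K) ^ 2 ∈ P.asIdeal := by convert h5 using 1; norm_num
    exact P.isPrime.mem_of_pow_mem 2 h6
  · exact absurd (Ideal.eq_top_of_isUnit_mem _ h5 v.isUnit) P.isPrime.ne_top

lemma isNormForm_unit (hodd : Odd (Nat.card (ClassGroup (𝓞 K))))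
    (hK : (primesAboveTwo K).Subsingleton) (u v : (𝓞 K)ˣ) :
    IsNormForm (algebraMap (𝓞 K) K u) (algebraMap (𝓞 K) K v) := by
  by_cases hsq : IsSquare (algebraMap (𝓞 K) K v)
  · obtain ⟨b, hb⟩ := hsq
    rw [hb, ← sq]
    refine isNormForm_sq _ ?_
    rintro rfl
    exact (v.isUnit.map (algebraMap (𝓞 K) K)).ne_zero (by rw [hb, mul_zero])
  · obtain ⟨M, _, _, _, s, h2, hs, hsK⟩ := exists_quadratic hsq
    rw [isNormForm_iff h2 hs hsK, ← mem_normUnits,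
      normUnits_eq_top h2 hodd hK (ramSet_subset_primesAboveTwo h2 v hs hsK)]
    exact Subgroup.mem_top _

/-- The primes not above `2` modulo which `ζ` is not a square and `u` is a square. -/
def goodPrimes (ζ u : (𝓞 K)ˣ) : Set (HeightOneSpectrum (𝓞 K)) :=
  {P | (2 : 𝓞 K) ∉ P.asIdeal ∧ ¬ IsSquare (Ideal.Quotient.mk P.asIdeal ζ) ∧
    IsSquare (Ideal.Quotient.mk P.asIdeal u)}

lemma isSquare_of_mem_normUnits (h2 : Module.finrank K L = 2) {P : HeightOneSpectrum (𝓞 K)}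
    (hP : P ∈ ramSet K L) {u : (𝓞 K)ˣ} (hu : u ∈ normUnits K L) :
    IsSquare (Ideal.Quotient.mk P.asIdeal u) := by
  obtain ⟨w, hw⟩ := exists_sq_sub_mem h2 hP hu
  refine ⟨Ideal.Quotient.mk _ w, ?_⟩
  rw [← map_mul, eq_comm, Ideal.Quotient.eq, ← sq]
  exact hw

lemma isSquare_of_mul {P : HeightOneSpectrum (𝓞 K)} {ζ u : (𝓞 K)ˣ}
    (h1 : IsSquare (Ideal.Quotient.mk P.asIdeal (ζ * u : (𝓞 K)ˣ)))
    (h2 : IsSquare (Ideal.Quotient.mk P.asIdeal u)) : IsSquare (Ideal.Quotient.mk P.asIdeal ζ) := by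
  have := P.isMaximal
  let := Ideal.Quotient.field P.asIdeal
  have hu : Ideal.Quotient.mk P.asIdeal u ≠ 0 := (u.isUnit.map (Ideal.Quotient.mk P.asIdeal)).ne_zero
  have h3 := h1.div h2
  rwa [Units.val_mul, map_mul, mul_div_cancel_right₀ _ hu] at h3

lemma isNormForm_of_mem_goodPrimes (hodd : Odd (Nat.card (ClassGroup (𝓞 K))))
    (hK : (primesAboveTwo K).Subsingleton) {ζ u : (𝓞 K)ˣ} {P : HeightOneSpectrum (𝓞 K)}
    (hP : P ∈ goodPrimes ζ u) {x : Kˣ} {h : ℕ} (hh : Odd h)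
    (hx : elemDiv (𝓞 K) K x = .ofAdd (Finsupp.single P (h : ℤ))) :
    IsNormForm (algebraMap (𝓞 K) K u) (x : K) := by
  classical
  by_cases hsq : IsSquare (x : K)
  · obtain ⟨b, hb⟩ := hsq
    rw [hb, ← sq]
    refine isNormForm_sq _ ?_
    rintro rfl
    exact x.ne_zero (by rw [hb, mul_zero])
  · obtain ⟨M, _, _, _, s, h2, hs, hsK⟩ := exists_quadratic hsq
    have hxv : ∀ Q : HeightOneSpectrum (𝓞 K), (elemDiv (𝓞 K) K x).toAdd Q = if P = Q then (h : ℤ) else 0 := by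
      intro Q
      rw [hx, toAdd_ofAdd, Finsupp.single_apply]
    obtain ⟨a, ha⟩ := HeightOneSpectrum.mem_integers_of_valuation_le_one (R := 𝓞 K) K (x : K) (by
      intro Q
      rw [valuation_eq_exp, hxv, ← WithZero.exp_zero, WithZero.exp_le_exp]
      split_ifs <;> simp)
    have hs0 : s ≠ 0 := fun h ↦ hsK ⟨0, by rw [h, map_zero]⟩
    have hPram : P ∈ ramSet K M := by
      refine mem_ramSet_of_odd h2 (s := Units.mk0 s hs0) hs P ?_
      rw [hxv, if_pos rfl]
      exact_mod_cast hh
    have hram : ramSet K M ⊆ insert P (primesAboveTwo K) := by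
      intro Q hQ
      rw [Set.mem_insert_iff, or_iff_not_imp_left]
      intro hQP
      have h4 := four_mul_mem h2 (a := a) (by rw [hs, ← ha]; rfl) hsK hQ
      rcases Q.isPrime.mem_or_mem h4 with h5 | h5
      · have h6 : (2 : 𝓞 K) ^ 2 ∈ Q.asIdeal := by convert h5 using 1; norm_num
        exact Q.isPrime.mem_of_pow_mem 2 h6
      · have h7 : Q.valuation K (algebraMap (𝓞 K) K a) < 1 := (Q.valuation_lt_one_iff_mem a).2 h5
        rw [ha, valuation_eq_exp, hxv, if_neg (Ne.symm hQP)] at h7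
        simp at h7
    have hdvd := two_mul_index_dvd h2 hodd (hK.finite.insert P) hram
    have hcard : (insert P (primesAboveTwo K)).ncard ≤ 2 := by
      refine (Set.ncard_insert_le _ _).trans ?_
      have := (Set.ncard_le_one hK.finite).2 fun a ha b hb ↦ hK ha hb
      omega
    have h4 := (dvd_of_mul_left_dvd hdvd).trans (pow_dvd_pow 2 hcard)
    have h5 : (normUnits K M).index ∣ 2 := Nat.dvd_of_mul_dvd_mul_left two_pos h4
    have hζ : ζ ∉ normUnits K M := fun h ↦ hP.2.1 (isSquare_of_mem_normUnits h2 hPram h)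
    rw [isNormForm_iff h2 hs hsK, ← mem_normUnits]
    by_contra hu
    rcases (Nat.dvd_prime Nat.prime_two).1 h5 with h6 | h6
    · rw [Subgroup.index_eq_one] at h6
      exact hζ (h6 ▸ Subgroup.mem_top _)
    · have h7 : ζ * u ∈ normUnits K M := (Subgroup.mul_mem_iff_of_index_two h6).2 (by simp [hζ, hu])
      exact hP.2.1 (isSquare_of_mul (isSquare_of_mem_normUnits h2 hPram h7) hP.2.2)

theorem isNormForm_of_goodPrimes (hodd : Odd (Nat.card (ClassGroup (𝓞 K))))
    (hK : (primesAboveTwo K).Subsingleton) {ζ u : (𝓞 K)ˣ} (a : Kˣ)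
    (ha : ∀ P, (elemDiv (𝓞 K) K a).toAdd P ≠ 0 → P ∈ goodPrimes ζ u) :
    IsNormForm (algebraMap (𝓞 K) K u) (a : K) := by
  set h := Nat.card (ClassGroup (𝓞 K)) with hh
  let R := normFormGroup (unitIncl K u)
  have hunit : (elemDiv (𝓞 K) K).ker ≤ R := by
    rw [ker_elemDiv]
    rintro _ ⟨v, rfl⟩
    exact isNormForm_unit hodd hK u v
  have key : ∀ D : HeightOneSpectrum (𝓞 K) →₀ ℤ, (∀ P, D P ≠ 0 → P ∈ goodPrimes ζ u) →
      Multiplicative.ofAdd D ∈ (R.map (elemDiv (𝓞 K) K)).comap (powMonoidHom h) := by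
    intro D hD
    rw [← Finsupp.sum_single D, Finsupp.sum, ofAdd_sum]
    refine Subgroup.prod_mem _ fun P hP ↦ ?_
    have h1 : Finsupp.single P (D P) = D P • Finsupp.single P (1 : ℤ) := by simp
    rw [h1, ofAdd_zsmul]
    refine Subgroup.zpow_mem _ ?_ _
    obtain ⟨x, hx⟩ := pow_classNumber_mem K (.ofAdd (Finsupp.single P (1 : ℤ)))
    refine ⟨x, ?_, hx⟩
    refine isNormForm_of_mem_goodPrimes hodd hK (hD P (Finsupp.mem_support_iff.1 hP)) hodd ?_
    rw [hx, ← ofAdd_nsmul, Finsupp.smul_single, nsmul_eq_mul, mul_one]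
  obtain ⟨x, hx, hxa⟩ := key _ ha
  refine mem_normFormGroup_of_pow (u := unitIncl K u) hodd ?_
  have h3 : a ^ h / x ∈ (elemDiv (𝓞 K) K).ker := by
    rw [MonoidHom.mem_ker, map_div, hxa, map_pow, div_eq_one]
    rfl
  have h4 := R.mul_mem (hunit h3) hx
  rwa [div_mul_cancel] at h4

end OddClassNumber

section Weber

open IsDedekindDomain IsCyclotomicExtension

universe u

lemma gaussian_isPrincipalIdealRing (K : Type*) [Field K] [NumberField K]
    [IsCyclotomicExtension {4} ℚ K] : IsPrincipalIdealRing (𝓞 K) := by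
  have : Fact (Nat.Prime 2) := ⟨Nat.prime_two⟩
  have h4 : Nat.totient 4 = 2 := by decide
  have h : NumberField.discr K = -4 := by
    have : IsCyclotomicExtension {2 ^ (1 + 1)} ℚ K := by norm_num; infer_instance
    have := IsCyclotomicExtension.Rat.discr_prime_pow_succ 2 1 K
    rw [this]
    norm_num [h4]
  apply RingOfIntegers.isPrincipalIdealRing_of_abs_discr_lt
  rw [h, IsCyclotomicExtension.finrank (n := 4) K (Polynomial.cyclotomic.irreducible_rat (by simp)),
    IsCyclotomicExtension.Rat.nrComplexPlaces_eq_totient_div_two 4, h4]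
  norm_num
  nlinarith [Real.pi_gt_three]

lemma primesAboveTwo_subsingleton (n : ℕ) (K : Type*) [Field K] [NumberField K]
    [IsCyclotomicExtension {2 ^ (n + 1)} ℚ K] : (primesAboveTwo K).Subsingleton := by
  have : Fact (Nat.Prime 2) := ⟨Nat.prime_two⟩
  have hζ := zeta_spec (2 ^ (n + 1)) ℚ K
  have key : ∀ P ∈ primesAboveTwo K, P.asIdeal = Ideal.span {hζ.toInteger - 1} := by
    intro P hP
    have : P.asIdeal.LiesOver (Ideal.span {((2 : ℕ) : ℤ)}) := by
      rw [Ideal.liesOver_iff]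
      refine Ideal.IsMaximal.eq_of_le (Int.ideal_span_isMaximal_of_prime 2)
        (P.isPrime.comap (algebraMap ℤ (𝓞 K))).ne_top ?_
      rw [Ideal.span_singleton_le_iff_mem, Ideal.mem_comap]
      simpa [primesAboveTwo] using hP
    have := P.isPrime
    exact IsCyclotomicExtension.Rat.eq_span_zeta_sub_one_of_liesOver 2 n K hζ P.asIdeal
  intro P hP Q hQ
  exact HeightOneSpectrum.ext ((key P hP).trans (key Q hQ).symm)

theorem odd_card_classGroup_cyclotomic (k : ℕ) : ∀ (K : Type u) [Field K] [NumberField K]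
    [IsCyclotomicExtension {2 ^ (k + 2)} ℚ K], Odd (Nat.card (ClassGroup (𝓞 K))) := by
  induction k with
  | zero =>
    intro K _ _ _
    have : IsCyclotomicExtension {4} ℚ K := by
      have : IsCyclotomicExtension {2 ^ (0 + 2)} ℚ K := inferInstance
      norm_num at this
      exact this
    have := gaussian_isPrincipalIdealRing K
    have h : Nat.card (ClassGroup (𝓞 K)) = 1 := by
      rw [Nat.card_eq_fintype_card, ← card_classGroup_eq_one (R := 𝓞 K)]
      congr!
    rw [h]
    exact odd_one
  | succ k ih =>
    intro L _ _ _
    have hζ := zeta_spec (2 ^ (k + 1 + 2)) ℚ L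
    set ζ := zeta (2 ^ (k + 1 + 2)) ℚ L
    have hζ2 : IsPrimitiveRoot (ζ ^ 2) (2 ^ (k + 2)) := hζ.pow (by positivity) (by ring)
    have hcyc : IsCyclotomicExtension {2 ^ (k + 2)} ℚ ℚ⟮ζ ^ 2⟯ :=
      (isCyclotomicExtension_singleton_iff_eq_adjoin _ _ _ _ hζ2).mpr rfl
    have hKcard : Module.finrank ℚ ℚ⟮ζ ^ 2⟯ = 2 ^ (k + 1) := by
      rw [IsCyclotomicExtension.finrank (n := 2 ^ (k + 2)) _
        (Polynomial.cyclotomic.irreducible_rat (by positivity)),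
        Nat.totient_prime_pow_succ Nat.prime_two]
      simp
    have hLcard : Module.finrank ℚ L = 2 ^ (k + 2) := by
      rw [IsCyclotomicExtension.finrank (n := 2 ^ (k + 1 + 2)) _
        (Polynomial.cyclotomic.irreducible_rat (by positivity)),
        Nat.totient_prime_pow_succ Nat.prime_two]
      simp
    have h2 : Module.finrank ℚ⟮ζ ^ 2⟯ L = 2 := by
      have := Module.finrank_mul_finrank ℚ ℚ⟮ζ ^ 2⟯ L
      rw [hKcard, hLcard, pow_succ 2 (k + 1)] at this
      exact Nat.eq_of_mul_eq_mul_left (by positivity) this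
    have : IsTotallyComplex ℚ⟮ζ ^ 2⟯ := IsCyclotomicExtension.Rat.isTotallyComplex _
      (n := 2 ^ (k + 2)) (by rw [pow_add]; have := Nat.one_le_two_pow (n := k); omega)
    let η : ℚ⟮ζ ^ 2⟯ := ⟨ζ ^ 2, mem_adjoin_simple_self ℚ _⟩
    have hη : IsPrimitiveRoot η (2 ^ (k + 2)) :=
      IsPrimitiveRoot.of_map_of_injective (f := algebraMap ℚ⟮ζ ^ 2⟯ L) hζ2
        (algebraMap ℚ⟮ζ ^ 2⟯ L).injective
    refine odd_card_classGroup h2 (ih _) (primesAboveTwo_subsingleton (k + 1) _)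
      (ramSet_subset_primesAboveTwo h2 (hη.toInteger_isPrimitiveRoot.isUnit (by positivity)).unit
        (s := ζ) rfl ?_)
    rintro ⟨x, hx⟩
    have hζx : IsPrimitiveRoot x (2 ^ (k + 1 + 2)) :=
      IsPrimitiveRoot.of_map_of_injective (f := algebraMap ℚ⟮ζ ^ 2⟯ L) (by rw [hx]; exact hζ)
        (algebraMap ℚ⟮ζ ^ 2⟯ L).injective
    have htop : ℚ⟮ζ⟯ = ⊤ :=
      ((isCyclotomicExtension_singleton_iff_eq_adjoin _ _ _ _ hζ).mp
        (IsCyclotomicExtension.equiv _ _ _ topEquiv.symm)).symm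
    have : ℚ⟮ζ ^ 2⟯ = ⊤ := by
      rw [eq_top_iff, ← htop, adjoin_simple_le_iff]
      have hmem := x.2
      rwa [show (x : L) = ζ from hx] at hmem
    rw [this] at h2
    simp at h2

end Weber

section Orders

lemma exists_pow_two_pow_eq {a m : ℕ} (hm : 2 ≤ m) (ha : ∃ c, a = 1 + 2 ^ m * (2 * c + 1)) (k : ℕ) :
    ∃ c, a ^ 2 ^ k = 1 + 2 ^ (m + k) * (2 * c + 1) := by
  induction k with
  | zero => simpa using ha
  | succ k ih =>
    obtain ⟨c, hc⟩ := ih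
    obtain ⟨j, rfl⟩ := Nat.exists_eq_add_of_le hm
    refine ⟨c + 2 ^ (j + k) * (2 * c + 1) ^ 2, ?_⟩
    rw [pow_succ, pow_mul, hc]
    ring

lemma exists_eq_of_mod_sixteen {Q : ℕ} (hQ : Q % 16 = 9) : ∃ c, Q = 1 + 2 ^ 3 * (2 * c + 1) :=
  ⟨Q / 16, by omega⟩

lemma orderOf_of_mod_sixteen {Q : ℕ} (hQ : Q % 16 = 9) (m : ℕ) :
    orderOf (Q : ZMod (2 ^ (m + 3))) = 2 ^ m := by
  have h1 : ∀ k j, ((Q : ZMod (2 ^ j)) ^ 2 ^ k = 1 ↔ j ≤ 3 + k) := by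
    intro k j
    obtain ⟨c, hc⟩ := exists_pow_two_pow_eq (by norm_num) (exists_eq_of_mod_sixteen hQ) k
    rw [← Nat.cast_pow, hc, Nat.cast_add, Nat.cast_one, add_eq_left, ZMod.natCast_eq_zero_iff,
      Nat.Coprime.dvd_mul_right (Nat.Coprime.pow_left _ (by simp)),
      Nat.pow_dvd_pow_iff_le_right (by norm_num)]
  cases m with
  | zero =>
    rw [pow_zero, orderOf_eq_one_iff]
    simpa using (h1 0 3).2 le_rfl
  | succ m =>
    have : Fact (Nat.Prime 2) := ⟨Nat.prime_two⟩
    refine orderOf_eq_prime_pow (fun h ↦ ?_) ?_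
    · have := (h1 _ _).1 h
      omega
    · exact (h1 _ _).2 (by omega)

lemma orderOf_of_sq_mod_sixteen {p : ℕ} (hp : p % 8 = 3 ∨ p % 8 = 5) (m : ℕ) :
    orderOf (p : ZMod (2 ^ (m + 3))) = 2 * 2 ^ m := by
  have hQ : p ^ 2 % 16 = 9 := by
    have h16 : p % 16 = 3 ∨ p % 16 = 11 ∨ p % 16 = 5 ∨ p % 16 = 13 := by omega
    rcases h16 with h | h | h | h <;> simp [Nat.pow_mod, h]
  have h1 := orderOf_of_mod_sixteen hQ m
  rw [Nat.cast_pow, orderOf_pow' _ two_ne_zero] at h1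
  have h2 : (p : ZMod (2 ^ (m + 3))) ≠ 1 := by
    intro h
    rw [← Nat.cast_one, ZMod.natCast_eq_natCast_iff] at h
    have := h.of_dvd (show 8 ∣ 2 ^ (m + 3) from ⟨2 ^ m, by ring⟩)
    unfold Nat.ModEq at this
    omega
  by_cases h3 : Even (orderOf (p : ZMod (2 ^ (m + 3))))
  · rw [Nat.gcd_eq_right h3.two_dvd] at h1
    have := h3.two_dvd
    omega
  · have h4 : Nat.gcd (orderOf (p : ZMod (2 ^ (m + 3)))) 2 = 1 := by
      exact (Nat.coprime_two_right).2 (Nat.not_even_iff_odd.1 h3)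
    rw [h4, Nat.div_one] at h1
    cases m with
    | zero => exact absurd (orderOf_eq_one_iff.1 h1) h2
    | succ m => exact absurd (h1 ▸ ⟨2 ^ m, by ring⟩) h3

end Orders

section Primes

open IsDedekindDomain IsCyclotomicExtension

variable (K : Type*) [Field K] [NumberField K]

/-- The primes of `K` containing the natural number `m`. -/
def primesAbove (m : ℕ) : Set (HeightOneSpectrum (𝓞 K)) := {P | (m : 𝓞 K) ∈ P.asIdeal}

variable {K}

lemma liesOver_of_mem {p : ℕ} (hp : p.Prime) {P : HeightOneSpectrum (𝓞 K)}
    (hP : P ∈ primesAbove K p) : P.asIdeal.LiesOver (Ideal.span {(p : ℤ)}) := by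
  have : Fact p.Prime := ⟨hp⟩
  rw [Ideal.liesOver_iff]
  refine Ideal.IsMaximal.eq_of_le (Int.ideal_span_isMaximal_of_prime p)
    (P.isPrime.comap (algebraMap ℤ (𝓞 K))).ne_top ?_
  rw [Ideal.span_singleton_le_iff_mem, Ideal.mem_comap]
  simpa [primesAbove] using hP

lemma natCast_mem_of_liesOver {p : ℕ} {P : Ideal (𝓞 K)} (h : P.LiesOver (Ideal.span {(p : ℤ)})) :
    (p : 𝓞 K) ∈ P := by
  have := (Ideal.liesOver_iff _ _).1 h
  have h2 : (p : ℤ) ∈ P.under ℤ := this ▸ Ideal.mem_span_singleton_self _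
  simpa using h2

lemma notMem_of_coprime {P : HeightOneSpectrum (𝓞 K)} {a b : ℕ} (hab : a.Coprime b)
    (ha : P ∈ primesAbove K a) : P ∉ primesAbove K b := by
  intro hb
  have h := hab.isCoprime.map (Int.castRingHom (𝓞 K))
  obtain ⟨x, y, hxy⟩ := h
  refine P.isPrime.ne_top ((Ideal.eq_top_iff_one _).2 (hxy ▸ Ideal.add_mem _ ?_ ?_))
  · exact Ideal.mul_mem_left _ _ (by simpa [primesAbove] using ha)
  · exact Ideal.mul_mem_left _ _ (by simpa [primesAbove] using hb)

lemma image_primesAbove {p : ℕ} (hp : p.Prime) :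
    HeightOneSpectrum.asIdeal '' primesAbove K p = (Ideal.span {(p : ℤ)}).primesOver (𝓞 K) := by
  ext P
  constructor
  · rintro ⟨P, hP, rfl⟩
    exact ⟨P.isPrime, liesOver_of_mem hp hP⟩
  · rintro ⟨h1, h2⟩
    have h3 := natCast_mem_of_liesOver h2
    refine ⟨⟨P, h1, ?_⟩, h3, rfl⟩
    rintro rfl
    exact hp.ne_zero (by simpa using h3)

lemma ncard_primesAbove {p : ℕ} (hp : p.Prime) :
    (primesAbove K p).ncard = ((Ideal.span {(p : ℤ)}).primesOver (𝓞 K)).ncard := by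
  rw [← image_primesAbove hp, Set.ncard_image_of_injective]
  exact fun P Q h ↦ HeightOneSpectrum.ext h

lemma finite_primesAbove {p : ℕ} (hp : p.Prime) : (primesAbove K p).Finite := by
  refine Set.Finite.of_finite_image (f := HeightOneSpectrum.asIdeal) ?_
    (fun P _ Q _ h ↦ HeightOneSpectrum.ext h)
  have : Fact p.Prime := ⟨hp⟩
  rw [image_primesAbove hp]
  exact Algebra.QuasiFinite.finite_primesOver _

lemma primesAbove_eq_biUnion {d : ℕ} (hd : d ≠ 0) :
    primesAbove K d = ⋃ p ∈ d.primeFactors, primesAbove K p := by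
  ext P
  simp only [Set.mem_iUnion, exists_prop]
  constructor
  · intro hP
    have h1 : (d : 𝓞 K) ∈ P.asIdeal := hP
    rw [← Nat.prod_primeFactorsList hd, Nat.cast_list_prod, ← Multiset.prod_coe,
      P.isPrime.multiset_prod_mem_iff_exists_mem] at h1
    obtain ⟨x, hx, hxP⟩ := h1
    obtain ⟨p, hp, rfl⟩ := List.mem_map.1 hx
    exact ⟨p, Nat.mem_primeFactors_iff_mem_primeFactorsList.2 hp, hxP⟩
  · rintro ⟨p, hp, hP⟩
    obtain ⟨c, rfl⟩ := Nat.dvd_of_mem_primeFactors hp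
    change ((p * c : ℕ) : 𝓞 K) ∈ P.asIdeal
    rw [Nat.cast_mul]
    exact Ideal.mul_mem_right _ _ hP

lemma ncard_primesAbove_eq_sum {d : ℕ} (hd : d ≠ 0) :
    (primesAbove K d).Finite ∧
      (primesAbove K d).ncard = ∑ p ∈ d.primeFactors, (primesAbove K p).ncard := by
  rw [primesAbove_eq_biUnion hd]
  refine ⟨d.primeFactors.finite_toSet.biUnion fun p hp ↦
    finite_primesAbove (Nat.prime_of_mem_primeFactors hp), ?_⟩
  rw [← finsum_mem_coe_finset, ← d.primeFactors.finite_toSet.ncard_biUnion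
    (fun p hp ↦ finite_primesAbove (Nat.prime_of_mem_primeFactors hp))]
  · rfl
  · intro p hp l hl hpl
    rw [Function.onFun, Set.disjoint_left]
    exact fun P ↦ notMem_of_coprime ((Nat.coprime_primes (Nat.prime_of_mem_primeFactors hp)
      (Nat.prime_of_mem_primeFactors hl)).2 hpl)

lemma ncard_primesAbove_mul {m : ℕ} [NeZero m] [IsCyclotomicExtension {m} ℚ K] {p : ℕ}
    (hp : p.Prime) (hm : ¬ p ∣ m) :
    (primesAbove K p).ncard * orderOf (p : ZMod m) = m.totient := by
  have : Fact p.Prime := ⟨hp⟩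
  have : IsGalois ℚ K := isGalois {m} ℚ K
  have h := Ideal.ncard_primesOver_mul_ramificationIdxIn_mul_inertiaDegIn (Ideal.span {(p : ℤ)})
    (𝓞 K) Gal(K/ℚ)
  rw [Rat.inertiaDegIn_eq_of_not_dvd p K hm, Rat.ramificationIdxIn_eq_of_not_dvd p K hm, one_mul,
    IsGaloisGroup.card_eq_finrank Gal(K/ℚ) ℚ K, IsCyclotomicExtension.finrank (n := m) K
      (Polynomial.cyclotomic.irreducible_rat (NeZero.pos m))] at h
  rw [ncard_primesAbove hp, h]

lemma card_residue {m : ℕ} [NeZero m] [IsCyclotomicExtension {m} ℚ K] {p : ℕ}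
    (hp : p.Prime) (hm : ¬ p ∣ m) {P : HeightOneSpectrum (𝓞 K)} (hP : P ∈ primesAbove K p) :
    Nat.card (𝓞 K ⧸ P.asIdeal) = p ^ orderOf (p : ZMod m) := by
  have : Fact p.Prime := ⟨hp⟩
  have := liesOver_of_mem hp hP
  have := P.isPrime
  have := P.isMaximal
  rw [← Rat.inertiaDeg_eq_of_not_dvd p K P.asIdeal hm, Ideal.pow_inertiaDeg]
  rfl

lemma elemDiv_natCast {m : ℕ} [NeZero m] [IsCyclotomicExtension {m} ℚ K] {d : ℕ}
    (hd : Squarefree d) (hm : d.Coprime m) {P : HeightOneSpectrum (𝓞 K)} (hP : P ∈ primesAbove K d)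
    {x : Kˣ} (hx : (x : K) = d) : (elemDiv (𝓞 K) K x).toAdd P = 1 := by
  rw [primesAbove_eq_biUnion hd.ne_zero] at hP
  simp only [Set.mem_iUnion, exists_prop] at hP
  obtain ⟨p, hpd, hP⟩ := hP
  have hp := Nat.prime_of_mem_primeFactors hpd
  have : Fact p.Prime := ⟨hp⟩
  have := liesOver_of_mem hp hP
  have := P.isPrime
  obtain ⟨c, rfl⟩ := Nat.dvd_of_mem_primeFactors hpd
  have hc : P ∉ primesAbove K c := notMem_of_coprime (Nat.squarefree_mul_iff.1 hd).1 hP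
  have hpm : ¬ p ∣ m := hp.coprime_iff_not_dvd.1 hm.coprime_mul_right
  have h1 := valuation_eq_exp (𝓞 K) K x P
  have h2 := Rat.ramificationIdx_eq_of_not_dvd p K P.asIdeal hpm
  have hp0 : (p : 𝓞 K) ≠ 0 := by exact_mod_cast hp.ne_zero
  rw [Ideal.IsDedekindDomain.ramificationIdx_eq_multiplicity (Ideal.span {(p : ℤ)}) P.asIdeal
    (by simpa [Ideal.map_span] using hp0)] at h2
  have h3 : P.valuation K (x : K) = WithZero.exp (-1) := by
    rw [hx, ← map_natCast (algebraMap (𝓞 K) K), P.valuation_of_algebraMap, Nat.cast_mul, map_mul,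
      HeightOneSpectrum.intValuation_eq_one_iff.2 hc, mul_one,
      HeightOneSpectrum.intValuation_eq_exp_neg_multiplicity _ hp0]
    simp only [Ideal.map_span, Set.image_singleton, map_natCast] at h2
    rw [h2]
    rfl
  rw [h3, WithZero.exp_inj] at h1
  omega

end Primes

section Frobenius

open IsDedekindDomain IsCyclotomicExtension

/-- The primes allowed as divisors of the radicand. -/
def IsAdmissible (p : ℕ) : Prop := p.Prime ∧ (p % 8 = 3 ∨ p % 8 = 5 ∨ p % 16 = 9)

lemma IsAdmissible.not_dvd {p : ℕ} (hp : IsAdmissible p) (m : ℕ) : ¬ p ∣ 2 ^ m := by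
  intro h
  have h2 := (Nat.prime_dvd_prime_iff_eq hp.1 Nat.prime_two).1 (hp.1.dvd_of_dvd_pow h)
  have := hp.2
  omega

lemma IsAdmissible.pow_orderOf_mod {p : ℕ} (hp : IsAdmissible p) :
    p ^ orderOf (p : ZMod (2 ^ 3)) % 16 = 9 := by
  have h16 : p % 16 = 3 ∨ p % 16 = 11 ∨ p % 16 = 5 ∨ p % 16 = 13 ∨ p % 16 = 9 := by
    have := hp.2
    omega
  rcases hp.2 with h | h | h
  · rw [orderOf_of_sq_mod_sixteen (.inl h) 0]
    rcases h16 with h' | h' | h' | h' | h' <;> first | omega | simp [Nat.pow_mod, h']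
  · rw [orderOf_of_sq_mod_sixteen (.inr h) 0]
    rcases h16 with h' | h' | h' | h' | h' <;> first | omega | simp [Nat.pow_mod, h']
  · rw [orderOf_of_mod_sixteen h 0]
    simpa using h

lemma IsAdmissible.orderOf_eq {p : ℕ} (hp : IsAdmissible p) (m : ℕ) :
    orderOf (p : ZMod (2 ^ (m + 3))) = orderOf (p : ZMod (2 ^ 3)) * 2 ^ m := by
  rcases or_assoc.2 hp.2 with h | h
  · rw [orderOf_of_sq_mod_sixteen h m, orderOf_of_sq_mod_sixteen h 0]
    simp
  · rw [orderOf_of_mod_sixteen h m, orderOf_of_mod_sixteen h 0]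
    simp

variable {m : ℕ} {K F : Type*} [Field K] [NumberField K] [IsCyclotomicExtension {2 ^ (m + 3)} ℚ K]
  [Field F] [NumberField F] [IsCyclotomicExtension {2 ^ 3} ℚ F] [Algebra F K]

lemma finrank_eq_two_pow (m : ℕ) (K : Type*) [Field K] [NumberField K]
    [IsCyclotomicExtension {2 ^ (m + 3)} ℚ K] : Module.finrank ℚ K = 2 ^ (m + 2) := by
  rw [IsCyclotomicExtension.finrank (n := 2 ^ (m + 3)) K
    (Polynomial.cyclotomic.irreducible_rat (by positivity)),
    Nat.totient_prime_pow_succ Nat.prime_two]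
  simp

include m in
lemma finrank_relative : Module.finrank F K = 2 ^ m := by
  have h := Module.finrank_mul_finrank ℚ F K
  rw [finrank_eq_two_pow m K, finrank_eq_two_pow 0 F, pow_add, mul_comm] at h
  simpa [pow_add] using h

lemma card_residue_under {p : ℕ} (hp : IsAdmissible p) {P : HeightOneSpectrum (𝓞 K)}
    (hP : P ∈ primesAbove K p) :
    Nat.card (𝓞 F ⧸ P.asIdeal.under (𝓞 F)) = p ^ orderOf (p : ZMod (2 ^ 3)) := by
  have hpF : (p : 𝓞 F) ∈ P.asIdeal.under (𝓞 F) := by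
    simpa [Ideal.mem_comap, primesAbove] using hP
  let PF : HeightOneSpectrum (𝓞 F) := ⟨P.asIdeal.under (𝓞 F), P.isPrime.comap _, by
    intro h
    rw [h] at hpF
    exact hp.1.ne_zero (by simpa using hpF)⟩
  exact card_residue (P := PF) hp.1 (hp.not_dvd 3) hpF

lemma exists_frobenius [IsGalois F K] {ζ : 𝓞 K} (hζ : IsPrimitiveRoot ζ (2 ^ (m + 3)))
    {p : ℕ} (hp : IsAdmissible p) {P : HeightOneSpectrum (𝓞 K)} (hP : P ∈ primesAbove K p) :
    ∃ σ : Gal(K/F), (∀ x : 𝓞 K, Ideal.Quotient.mk P.asIdeal (σ • x) =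
      Ideal.Quotient.mk P.asIdeal x ^ p ^ orderOf (p : ZMod (2 ^ 3))) ∧
      σ • ζ = ζ ^ p ^ orderOf (p : ZMod (2 ^ 3)) := by
  have := P.isPrime
  have : Finite (𝓞 K ⧸ P.asIdeal) := Ring.HasFiniteQuotients.finiteQuotient P.ne_bot
  obtain ⟨σ, hσ⟩ := IsArithFrobAt.exists_of_isInvariant (𝓞 F) Gal(K/F) P.asIdeal
  refine ⟨σ, fun x ↦ ?_, ?_⟩
  · have h := AlgHom.IsArithFrobAt.mk_apply hσ x
    rwa [card_residue_under hp hP] at h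
  · have h := AlgHom.IsArithFrobAt.apply_of_pow_eq_one hσ hζ.pow_eq_one (by
      have h1 : p.Coprime (2 ^ (m + 3)) := hp.1.coprime_iff_not_dvd.2 (hp.not_dvd _)
      have h2 := notMem_of_coprime h1 hP
      exact h2)
    rwa [card_residue_under hp hP] at h

lemma pow_smul_of_smul {ζ : 𝓞 K} {Q : ℕ} {σ : Gal(K/F)} (hσ : σ • ζ = ζ ^ Q) (i : ℕ) :
    σ ^ i • ζ = ζ ^ Q ^ i := by
  induction i with
  | zero => simp
  | succ i ih => rw [pow_succ', mul_smul, ih, smul_pow', hσ, ← pow_mul, pow_succ']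

/-- The Frobenius generates the relative Galois group. -/
lemma prod_galois [IsGalois F K] {ζ : 𝓞 K} (hζ : IsPrimitiveRoot ζ (2 ^ (m + 3))) {Q : ℕ}
    (hQ : Q % 16 = 9) {σ : Gal(K/F)} (hσ : σ • ζ = ζ ^ Q) (x : 𝓞 K) :
    ∏ τ : Gal(K/F), τ • x = ∏ i ∈ Finset.range (2 ^ m), σ ^ i • x := by
  classical
  have hpow := pow_smul_of_smul hσ
  have hinj : Set.InjOn (fun i ↦ σ ^ i) (Finset.range (2 ^ m) : Set ℕ) := by
    intro i hi j hj hij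
    have h1 : ζ ^ Q ^ i = ζ ^ Q ^ j := by rw [← hpow, ← hpow]; exact congrArg (· • ζ) hij
    rw [(hζ.isOfFinOrder (by positivity)).pow_inj_mod, ← hζ.eq_orderOf,
      ← ZMod.natCast_eq_natCast_iff', Nat.cast_pow, Nat.cast_pow] at h1
    refine pow_injOn_Iio_orderOf ?_ ?_ h1
    · rw [orderOf_of_mod_sixteen hQ m]
      simpa using hi
    · rw [orderOf_of_mod_sixteen hQ m]
      simpa using hj
  have himg : (Finset.range (2 ^ m)).image (fun i ↦ σ ^ i) = Finset.univ := by
    rw [← Finset.card_eq_iff_eq_univ, Finset.card_image_of_injOn hinj, Finset.card_range,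
      ← Nat.card_eq_fintype_card, IsGalois.card_aut_eq_finrank, finrank_relative (m := m)]
  rw [← himg, Finset.prod_image hinj]

lemma smul_eq_pow {Q : ℕ} {P : HeightOneSpectrum (𝓞 K)} {σ : Gal(K/F)}
    (hσ : ∀ x : 𝓞 K, Ideal.Quotient.mk P.asIdeal (σ • x) = Ideal.Quotient.mk P.asIdeal x ^ Q)
    (i : ℕ) (x : 𝓞 K) :
    Ideal.Quotient.mk P.asIdeal (σ ^ i • x) = Ideal.Quotient.mk P.asIdeal x ^ Q ^ i := by
  induction i with
  | zero => simp
  | succ i ih => rw [pow_succ', mul_smul, hσ, ih, ← pow_mul, pow_succ]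

lemma algebraMap_norm_eq [IsGalois F K] (x : 𝓞 K) :
    algebraMap (𝓞 F) (𝓞 K) (RingOfIntegers.norm F x) = ∏ τ : Gal(K/F), τ • x := by
  refine RingOfIntegers.ext ?_
  rw [RingOfIntegers.coe_algebraMap_norm, Algebra.norm_eq_prod_automorphisms]
  exact (map_prod (algebraMap (𝓞 K) K) (fun τ : Gal(K/F) ↦ τ • x) Finset.univ).symm

lemma geom_div {Q m : ℕ} (hQ : Q % 16 = 9) :
    (∑ i ∈ Finset.range m, Q ^ i) * (Q / 2) = Q ^ m / 2 := by
  obtain ⟨c, rfl⟩ : ∃ c, Q = 2 * c + 1 := ⟨Q / 2, by omega⟩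
  have h1 : (∑ i ∈ Finset.range m, (2 * c + 1) ^ i) * (2 * c) + 1 = (2 * c + 1) ^ m := by
    have := geom_sum_mul_add (2 * c) m
    exact this
  rw [← h1, show (2 * c + 1) / 2 = c by omega,
    show (∑ i ∈ Finset.range m, (2 * c + 1) ^ i) * (2 * c) + 1 =
      2 * ((∑ i ∈ Finset.range m, (2 * c + 1) ^ i) * c) + 1 by ring]
  omega

theorem norm_pow_eq [IsGalois F K] {ζ : 𝓞 K} (hζ : IsPrimitiveRoot ζ (2 ^ (m + 3)))
    {p : ℕ} (hp : IsAdmissible p) {P : HeightOneSpectrum (𝓞 K)} (hP : P ∈ primesAbove K p)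
    (x : 𝓞 K) :
    Ideal.Quotient.mk P.asIdeal (algebraMap (𝓞 F) (𝓞 K) (RingOfIntegers.norm F x)) ^
      (p ^ orderOf (p : ZMod (2 ^ 3)) / 2) =
    Ideal.Quotient.mk P.asIdeal x ^ (Nat.card (𝓞 K ⧸ P.asIdeal) / 2) := by
  obtain ⟨σ, h1, h2⟩ := exists_frobenius (F := F) hζ hp hP
  rw [algebraMap_norm_eq, prod_galois hζ hp.pow_orderOf_mod h2, map_prod,
    Finset.prod_congr rfl fun i _ ↦ smul_eq_pow h1 i x, Finset.prod_pow_eq_pow_sum, ← pow_mul,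
    geom_div hp.pow_orderOf_mod, card_residue hp.1 (hp.not_dvd (m + 3)) hP, hp.orderOf_eq m,
    pow_mul]

lemma pow_eq_one_of_mem_base [IsGalois F K] {ζ : 𝓞 K} (hζ : IsPrimitiveRoot ζ (2 ^ (m + 3)))
    {p : ℕ} (hp : IsAdmissible p) {P : HeightOneSpectrum (𝓞 K)} (hP : P ∈ primesAbove K p)
    (w : (𝓞 F)ˣ) :
    Ideal.Quotient.mk P.asIdeal (algebraMap (𝓞 F) (𝓞 K) w) ^
      (p ^ orderOf (p : ZMod (2 ^ 3)) - 1) = 1 := by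
  obtain ⟨σ, h1, -⟩ := exists_frobenius (F := F) hζ hp hP
  have h := h1 (algebraMap (𝓞 F) (𝓞 K) w)
  rw [smul_algebraMap] at h
  have hu : IsUnit (Ideal.Quotient.mk P.asIdeal (algebraMap (𝓞 F) (𝓞 K) w)) :=
    (w.isUnit.map (algebraMap (𝓞 F) (𝓞 K))).map _
  have hQ : p ^ orderOf (p : ZMod (2 ^ 3)) ≠ 0 := pow_ne_zero _ hp.1.ne_zero
  refine hu.mul_left_cancel ?_
  rw [mul_pow_sub_one hQ, mul_one, ← h]

end Frobenius

section Residue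

open IsDedekindDomain IsCyclotomicExtension

lemma prod_one_sub_pow {R : Type*} [CommRing R] [IsDomain R] {m : ℕ} {ξ : R}
    (hξ : IsPrimitiveRoot ξ (2 ^ (m + 3))) {Q : ℕ} (hQ : Q % 16 = 9) :
    ∏ i ∈ Finset.range (2 ^ m), (1 - ξ ^ Q ^ i) = 1 - ξ ^ 2 ^ m := by
  classical
  have hξ8 : IsPrimitiveRoot (ξ ^ 2 ^ 3) (2 ^ m) :=
    hξ.pow (by positivity) (by rw [← pow_add, add_comm])
  have hpos : ∀ i, 0 < Q ^ i := fun i ↦ pow_pos (by omega) i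
  have h8 : ∀ i, 2 ^ 3 ∣ Q ^ i - 1 := fun i ↦ by
    have h : Q ^ i % 8 = 1 := by
      rw [Nat.pow_mod, show Q % 8 = 1 by omega]
      simp
    have := hpos i
    omega
  have hinj : Set.InjOn (fun i ↦ ξ ^ (Q ^ i - 1)) (Finset.range (2 ^ m) : Set ℕ) := by
    intro i hi j hj hij
    have h1 : ξ ^ Q ^ i = ξ ^ Q ^ j := by
      rw [← Nat.sub_add_cancel (hpos i), ← Nat.sub_add_cancel (hpos j), pow_succ, pow_succ]
      exact congrArg (· * ξ) hij
    rw [(hξ.isOfFinOrder (by positivity)).pow_inj_mod, ← hξ.eq_orderOf,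
      ← ZMod.natCast_eq_natCast_iff', Nat.cast_pow, Nat.cast_pow] at h1
    refine pow_injOn_Iio_orderOf ?_ ?_ h1
    · rw [orderOf_of_mod_sixteen hQ m]
      simpa using hi
    · rw [orderOf_of_mod_sixteen hQ m]
      simpa using hj
  have himg : (Finset.range (2 ^ m)).image (fun i ↦ ξ ^ (Q ^ i - 1)) =
      Polynomial.nthRootsFinset (2 ^ m) (1 : R) := by
    refine Finset.eq_of_subset_of_card_le ?_ ?_
    · intro x hx
      obtain ⟨i, -, rfl⟩ := Finset.mem_image.1 hx
      obtain ⟨c, hc⟩ := h8 i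
      rw [Polynomial.mem_nthRootsFinset (by positivity), hc, pow_mul, pow_right_comm,
        hξ8.pow_eq_one, one_pow]
    · rw [hξ8.card_nthRootsFinset, Finset.card_image_of_injOn hinj, Finset.card_range]
  have h := hξ8.pow_sub_pow_eq_prod_sub_mul 1 ξ (by positivity)
  rw [one_pow, ← himg, Finset.prod_image hinj] at h
  rw [h]
  refine Finset.prod_congr rfl fun i _ ↦ ?_
  rw [← pow_succ, Nat.sub_add_cancel (hpos i)]

variable {m : ℕ} {K F : Type*} [Field K] [NumberField K] [IsCyclotomicExtension {2 ^ (m + 3)} ℚ K]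
  [Field F] [NumberField F] [IsCyclotomicExtension {2 ^ 3} ℚ F] [Algebra F K]

lemma two_notMem {p : ℕ} (hp : IsAdmissible p) {P : HeightOneSpectrum (𝓞 K)}
    (hP : P ∈ primesAbove K p) : (2 : 𝓞 K) ∉ P.asIdeal := by
  have h1 : p.Coprime 2 := hp.1.coprime_iff_not_dvd.2 (by simpa using hp.not_dvd 1)
  have h2 := notMem_of_coprime h1 hP
  simpa [primesAbove] using h2

lemma two_ne_zero_residue {p : ℕ} (hp : IsAdmissible p) {P : HeightOneSpectrum (𝓞 K)}
    (hP : P ∈ primesAbove K p) : (2 : 𝓞 K ⧸ P.asIdeal) ≠ 0 := by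
  intro h
  refine two_notMem hp hP ?_
  rw [← Ideal.Quotient.eq_zero_iff_mem, map_ofNat]
  exact h

lemma isSquare_mk_iff {p : ℕ} (hp : IsAdmissible p) {P : HeightOneSpectrum (𝓞 K)}
    (hP : P ∈ primesAbove K p) (u : (𝓞 K)ˣ) :
    IsSquare (Ideal.Quotient.mk P.asIdeal u) ↔
      Ideal.Quotient.mk P.asIdeal u ^ (Nat.card (𝓞 K ⧸ P.asIdeal) / 2) = 1 := by
  have : P.asIdeal.IsMaximal := P.isMaximal
  have : Finite (𝓞 K ⧸ P.asIdeal) := Ring.HasFiniteQuotients.finiteQuotient P.ne_bot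
  let := Fintype.ofFinite (𝓞 K ⧸ P.asIdeal)
  let := Ideal.Quotient.field P.asIdeal
  have h2 := two_ne_zero_residue hp hP
  rw [Nat.card_eq_fintype_card]
  refine FiniteField.isSquare_iff (fun h ↦ h2 ?_) ((u.isUnit.map _).ne_zero)
  have := ringChar.spec (𝓞 K ⧸ P.asIdeal) 2
  rw [h] at this
  simpa using this.2 dvd_rfl

lemma not_isSquare_root {ζ : (𝓞 K)ˣ} (hζ : IsPrimitiveRoot (ζ : 𝓞 K) (2 ^ (m + 3)))
    {p : ℕ} (hp : IsAdmissible p) {P : HeightOneSpectrum (𝓞 K)} (hP : P ∈ primesAbove K p) :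
    ¬ IsSquare (Ideal.Quotient.mk P.asIdeal ζ) := by
  rw [isSquare_mk_iff hp hP, card_residue hp.1 (hp.not_dvd (m + 3)) hP, hp.orderOf_eq m, pow_mul]
  obtain ⟨c, hc⟩ := exists_pow_two_pow_eq (by norm_num)
    (exists_eq_of_mod_sixteen hp.pow_orderOf_mod) m
  have hneg : (ζ : 𝓞 K) ^ 2 ^ (m + 2) = -1 :=
    (hζ.pow (by positivity) (by rw [pow_succ])).eq_neg_one_of_two_right
  have hdiv : (p ^ orderOf (p : ZMod (2 ^ 3))) ^ 2 ^ m / 2 = 2 ^ (m + 2) * (2 * c + 1) := by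
    rw [hc, show 1 + 2 ^ (3 + m) * (2 * c + 1) = 2 * (2 ^ (m + 2) * (2 * c + 1)) + 1 by ring]
    omega
  rw [hdiv, ← map_pow, pow_mul, hneg, Odd.neg_one_pow ⟨c, rfl⟩, map_neg, map_one]
  intro h
  refine two_ne_zero_residue hp hP ?_
  rw [← one_add_one_eq_two]
  nth_rewrite 1 [← h]
  simp

lemma isSquare_of_norm_eq_sq [IsGalois F K] {ζ : 𝓞 K} (hζ : IsPrimitiveRoot ζ (2 ^ (m + 3)))
    {p : ℕ} (hp : IsAdmissible p) {P : HeightOneSpectrum (𝓞 K)} (hP : P ∈ primesAbove K p)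
    {u : (𝓞 K)ˣ} {w : (𝓞 F)ˣ} (hu : RingOfIntegers.norm F (u : 𝓞 K) = w ^ 2) :
    IsSquare (Ideal.Quotient.mk P.asIdeal u) := by
  rw [isSquare_mk_iff hp hP, ← norm_pow_eq (F := F) hζ hp hP, hu, map_pow, map_pow, ← pow_mul,
    show 2 * (p ^ orderOf (p : ZMod (2 ^ 3)) / 2) = p ^ orderOf (p : ZMod (2 ^ 3)) - 1 by
      have := hp.pow_orderOf_mod
      omega]
  exact pow_eq_one_of_mem_base hζ hp hP w

theorem goodPrimes_of_norm_eq_sq [IsGalois F K] {ζ : (𝓞 K)ˣ}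
    (hζ : IsPrimitiveRoot (ζ : 𝓞 K) (2 ^ (m + 3)))
    {p : ℕ} (hp : IsAdmissible p) {P : HeightOneSpectrum (𝓞 K)} (hP : P ∈ primesAbove K p)
    {u : (𝓞 K)ˣ} {w : (𝓞 F)ˣ} (hu : RingOfIntegers.norm F (u : 𝓞 K) = w ^ 2) :
    P ∈ goodPrimes ζ u :=
  ⟨two_notMem hp hP, not_isSquare_root hζ hp hP, isSquare_of_norm_eq_sq hζ hp hP hu⟩

lemma algebraMap_norm_one_sub [IsGalois F K] {ζ : 𝓞 K}
    (hζ : IsPrimitiveRoot ζ (2 ^ (m + 3))) {Q : ℕ} (hQ : Q % 16 = 9) {σ : Gal(K/F)}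
    (hσ : σ • ζ = ζ ^ Q) :
    algebraMap (𝓞 F) (𝓞 K) (RingOfIntegers.norm F (1 - ζ)) = 1 - ζ ^ 2 ^ m := by
  have hpow := pow_smul_of_smul hσ
  rw [algebraMap_norm_eq, prod_galois hζ hQ hσ, ← prod_one_sub_pow hζ hQ]
  refine Finset.prod_congr rfl fun i _ ↦ ?_
  rw [smul_sub, smul_one, hpow]

lemma algebraMap_norm_cyclotomicUnit [IsGalois F K] {ζ : 𝓞 K}
    (hζ : IsPrimitiveRoot ζ (2 ^ (m + 3))) {p : ℕ} (hp : IsAdmissible p)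
    {P : HeightOneSpectrum (𝓞 K)} (hP : P ∈ primesAbove K p)
    {u : 𝓞 K} (hu : u * (1 - ζ) = 1 - ζ ^ 5) :
    algebraMap (𝓞 F) (𝓞 K) (RingOfIntegers.norm F u) * (1 - ζ ^ 2 ^ m) = 1 + ζ ^ 2 ^ m := by
  obtain ⟨σ, -, hσ⟩ := exists_frobenius (F := F) hζ hp hP
  have hσ5 : σ • ζ ^ 5 = (ζ ^ 5) ^ p ^ orderOf (p : ZMod (2 ^ 3)) := by
    rw [smul_pow', hσ, pow_right_comm]
  have hζ5 : IsPrimitiveRoot (ζ ^ 5) (2 ^ (m + 3)) :=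
    hζ.pow_of_coprime 5 (Nat.Coprime.pow_right _ (by norm_num))
  have h4 : (ζ ^ 2 ^ m) ^ 4 = -1 := by
    rw [← pow_mul, show 2 ^ m * 4 = 2 ^ (m + 2) by ring]
    exact (hζ.pow (by positivity) (by rw [pow_succ])).eq_neg_one_of_two_right
  have h := algebraMap_norm_one_sub (F := F) hζ5 hp.pow_orderOf_mod hσ5
  rw [← hu, map_mul, map_mul, algebraMap_norm_one_sub (F := F) hζ hp.pow_orderOf_mod hσ,
    pow_right_comm, pow_succ _ 4, h4] at h
  rw [h]
  ring

/-- The quadratic character of `(1 + y) / (1 - y)` for a primitive eighth root of unity `y`. -/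
lemma pow_of_mod_five {κ : Type*} [Field κ] {p : ℕ} [Fact p.Prime] [CharP κ p] (hp : p % 8 = 5)
    {y v : κ} (hy : y ^ 4 = -1) (h2 : (2 : κ) ≠ 0) (hv : v * (1 - y) = 1 + y) :
    v ^ (p ^ 2 / 2) = 1 := by
  have hyp : y ^ p = -y := by
    obtain ⟨c, rfl⟩ : ∃ c, p = 4 * (2 * c + 1) + 1 := ⟨p / 8, by omega⟩
    rw [pow_succ, pow_mul, hy, Odd.neg_one_pow ⟨c, rfl⟩, neg_one_mul]
  have h := congrArg (· ^ p) hv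
  simp only [mul_pow, sub_pow_char, add_pow_char, one_pow, hyp] at h
  have h1 : 1 - y ≠ 0 := fun h ↦ h2 (by
    rw [← sub_eq_zero.1 h] at hy
    linear_combination hy)
  have h1' : 1 + y ≠ 0 := fun h ↦ h2 (by
    rw [show y = -1 by linear_combination h] at hy
    linear_combination hy)
  have h3 : v ^ (p + 1) = 1 := by
    refine mul_right_cancel₀ (mul_ne_zero h1 h1') ?_
    rw [pow_succ]
    linear_combination v ^ p * (1 + y) * hv + (1 + y) * h
  obtain ⟨c, rfl⟩ : ∃ c, p = 2 * c + 1 := ⟨p / 2, by omega⟩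
  rw [show (2 * c + 1) ^ 2 / 2 = (2 * c + 1 + 1) * c by
    rw [show (2 * c + 1) ^ 2 = 2 * ((2 * c + 1 + 1) * c) + 1 by ring]; omega, pow_mul, h3, one_pow]

lemma pow_of_mod_three {κ : Type*} [Field κ] {p : ℕ} [Fact p.Prime] [CharP κ p] (hp : p % 8 = 3)
    {y v : κ} (hy : y ^ 4 = -1) (h2 : (2 : κ) ≠ 0) (hv : v * (1 - y) = 1 + y) :
    v ^ (p ^ 2 / 2) = -1 := by
  have hyp : y ^ p = y ^ 3 := by
    obtain ⟨c, rfl⟩ : ∃ c, p = 4 * (2 * c) + 3 := ⟨p / 8, by omega⟩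
    rw [pow_add, pow_mul, hy, Even.neg_one_pow ⟨c, by ring⟩, one_mul]
  have h := congrArg (· ^ p) hv
  simp only [mul_pow, sub_pow_char, add_pow_char, one_pow, hyp] at h
  have h1 : 1 - y ≠ 0 := fun h ↦ h2 (by
    rw [← sub_eq_zero.1 h] at hy
    linear_combination hy)
  have h1' : 1 - y ^ 3 ≠ 0 := fun h ↦ h2 (by
    have h0 : y = -1 := by linear_combination hy - y * (-h)
    rw [h0] at h
    linear_combination h)
  have h3 : v ^ (p + 1) = -1 := by
    refine mul_right_cancel₀ (mul_ne_zero h1 h1') ?_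
    rw [pow_succ]
    linear_combination v ^ p * (1 - y ^ 3) * hv + (1 + y) * h + 2 * hy
  obtain ⟨c, rfl⟩ : ∃ c, p = 2 * (2 * c + 1) + 1 := ⟨p / 4, by omega⟩
  rw [show (2 * (2 * c + 1) + 1) ^ 2 / 2 = (2 * (2 * c + 1) + 1 + 1) * (2 * c + 1) by
    rw [show (2 * (2 * c + 1) + 1) ^ 2 = 2 * ((2 * (2 * c + 1) + 1 + 1) * (2 * c + 1)) + 1 by ring]
    omega, pow_mul, h3, Odd.neg_one_pow ⟨c, rfl⟩]

include m F in
theorem isSquare_cyclotomicUnit_iff [IsGalois F K] {ζ : 𝓞 K}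
    (hζ : IsPrimitiveRoot ζ (2 ^ (m + 3))) {p : ℕ} (hp : p.Prime) (h : p % 8 = 3 ∨ p % 8 = 5)
    {P : HeightOneSpectrum (𝓞 K)} (hP : P ∈ primesAbove K p)
    {u : (𝓞 K)ˣ} (hu : u * (1 - ζ) = 1 - ζ ^ 5) :
    IsSquare (Ideal.Quotient.mk P.asIdeal u) ↔ p % 8 = 5 := by
  have hp' : IsAdmissible p := ⟨hp, by tauto⟩
  have : P.asIdeal.IsMaximal := P.isMaximal
  let := Ideal.Quotient.field P.asIdeal
  have : Fact p.Prime := ⟨hp⟩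
  have h2 := two_ne_zero_residue hp' hP
  have : CharP (𝓞 K ⧸ P.asIdeal) p := by
    have h0 : ((p : ℕ) : 𝓞 K ⧸ P.asIdeal) = 0 := by
      rw [← map_natCast (Ideal.Quotient.mk P.asIdeal), Ideal.Quotient.eq_zero_iff_mem]
      exact hP
    exact (CharP.charP_iff_prime_eq_zero hp).2 h0
  have h4 : (Ideal.Quotient.mk P.asIdeal (ζ ^ 2 ^ m)) ^ 4 = -1 := by
    rw [← map_pow, ← pow_mul, show 2 ^ m * 4 = 2 ^ (m + 2) by ring,
      (hζ.pow (by positivity) (by rw [pow_succ])).eq_neg_one_of_two_right, map_neg, map_one]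
  have hv := congrArg (Ideal.Quotient.mk P.asIdeal)
    (algebraMap_norm_cyclotomicUnit (F := F) hζ hp' hP hu)
  rw [map_mul, map_sub, map_add, map_one] at hv
  rw [isSquare_mk_iff hp' hP, ← norm_pow_eq (F := F) hζ hp' hP, orderOf_of_sq_mod_sixteen h 0,
    pow_zero, mul_one]
  rcases h with h | h
  · rw [pow_of_mod_three h h4 h2 hv]
    refine iff_of_false (fun h' ↦ h2 ?_) (by omega)
    linear_combination -h'
  · rw [pow_of_mod_five h h4 h2 hv]
    exact iff_of_true rfl h

end Residue

section Index

open IsDedekindDomain IsCyclotomicExtension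

universe u

lemma index_range_sq_units (F : Type*) [Field F] [NumberField F] :
    (powMonoidHom 2 : (𝓞 F)ˣ →* (𝓞 F)ˣ).range.index = 2 ^ (Units.rank F + 1) := by
  have : Module.Finite ℤ (Additive (⊤ : Subgroup (𝓞 F)ˣ)) :=
    finite_of_injective (⊤ : Subgroup (𝓞 F)ˣ).subtype Subtype.val_injective
  have h := relIndex_squares (⊤ : Subgroup (𝓞 F)ˣ)
  rwa [card_two_torsion _ (Subgroup.mem_top _), Subgroup.relIndex_top_right,
    ← MonoidHom.range_eq_map, finrank_of_mulEquiv Subgroup.topEquiv, NumberField.Units.finrank_eq,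
    ← pow_succ] at h

lemma isTotallyComplex_two_pow (m : ℕ) (K : Type*) [Field K] [NumberField K]
    [IsCyclotomicExtension {2 ^ (m + 3)} ℚ K] : IsTotallyComplex K :=
  IsCyclotomicExtension.Rat.isTotallyComplex K (n := 2 ^ (m + 3)) (by
    rw [pow_add]
    have : 0 < 2 ^ m := by positivity
    omega)

lemma rank_of_eight (F : Type*) [Field F] [NumberField F] [IsCyclotomicExtension {2 ^ 3} ℚ F] :
    Units.rank F = 1 := by
  have := isTotallyComplex_two_pow 0 F
  have h1 : Module.finrank ℚ F = 4 := finrank_eq_two_pow 0 F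
  have h2 := IsTotallyComplex.finrank F
  rw [Units.rank, InfinitePlace.card_eq_nrRealPlaces_add_nrComplexPlaces,
    IsTotallyComplex.nrRealPlaces_eq_zero]
  omega

lemma mem_primesAbove_of_elemDiv {K : Type*} [Field K] [NumberField K] {d : ℕ} {x : Kˣ}
    (hx : (x : K) = d) {P : HeightOneSpectrum (𝓞 K)} (hP : (elemDiv (𝓞 K) K x).toAdd P ≠ 0) :
    P ∈ primesAbove K d := by
  by_contra h
  refine hP ?_
  have h1 := valuation_eq_exp (𝓞 K) K x P
  rw [hx, ← map_natCast (algebraMap (𝓞 K) K), HeightOneSpectrum.valuation_of_algebraMap,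
    HeightOneSpectrum.intValuation_eq_one_iff.2 h, ← WithZero.exp_zero] at h1
  have := WithZero.exp_injective h1
  omega

variable {m : ℕ} {K : Type u} {F : Type*} [Field K] [NumberField K]
  [IsCyclotomicExtension {2 ^ (m + 3)} ℚ K]
  [Field F] [NumberField F] [IsCyclotomicExtension {2 ^ 3} ℚ F] [Algebra F K] [IsGalois F K]
  {L : Type u} [Field L] [NumberField L] [Algebra K L]

lemma exists_cyclotomicUnit {ζ : 𝓞 K} (hζ : IsPrimitiveRoot ζ (2 ^ (m + 3))) :
    ∃ u : (𝓞 K)ˣ, u * (1 - ζ) = 1 - ζ ^ 5 := by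
  obtain ⟨u, hu⟩ := hζ.associated_sub_one_pow_sub_one_of_coprime (j := 5)
    (Nat.Coprime.pow_right _ (by norm_num))
  exact ⟨u, by linear_combination -hu⟩

variable {d : ℕ} {s : L}

include m F in
lemma normUnits_index_dvd (h2 : Module.finrank K L = 2) (hs : s ^ 2 = d)
    (hsK : s ∉ Set.range (algebraMap K L)) (hd : d ≠ 0)
    (hall : ∀ p, p.Prime → p ∣ d → IsAdmissible p)
    {ζ : (𝓞 K)ˣ} (hζ : IsPrimitiveRoot (ζ : 𝓞 K) (2 ^ (m + 3))) :
    (normUnits K L).index ∣ 4 := by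
  have := isTotallyComplex_two_pow m K
  let H := (powMonoidHom 2 : (𝓞 F)ˣ →* (𝓞 F)ˣ).range.comap
    (Units.map (RingOfIntegers.norm F : 𝓞 K →* 𝓞 F))
  have hH : H.index ∣ 4 := by
    rw [Subgroup.index_comap]
    refine (Subgroup.relIndex_dvd_index_of_normal _ _).trans ?_
    rw [index_range_sq_units, rank_of_eight]
    norm_num
  refine (Subgroup.index_dvd_of_le ?_).trans hH
  rintro u ⟨w, hw⟩
  have hw' : RingOfIntegers.norm F (u : 𝓞 K) = w ^ 2 := (congrArg Units.val hw).symm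
  have hd0 : (d : K) ≠ 0 := by exact_mod_cast hd
  rw [mem_normUnits, ← isNormForm_iff h2 (a := (d : K)) (by simpa using hs) hsK]
  refine isNormForm_of_goodPrimes (ζ := ζ) (odd_card_classGroup_cyclotomic (m + 1) K)
    (primesAboveTwo_subsingleton (m + 2) K) (Units.mk0 (d : K) hd0) fun P hP ↦ ?_
  have h3 := mem_primesAbove_of_elemDiv (Units.val_mk0 hd0) hP
  rw [primesAbove_eq_biUnion hd] at h3
  simp only [Set.mem_iUnion, exists_prop, Nat.mem_primeFactors] at h3
  obtain ⟨p, ⟨hp, hpd, -⟩, hPp⟩ := h3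
  exact goodPrimes_of_norm_eq_sq hζ (hall p hp hpd) hPp hw'

include m in
lemma mem_ramSet_of_mem_primesAbove (h2 : Module.finrank K L = 2) (hs : s ^ 2 = d)
    (hd : Squarefree d) (hodd : Odd d) {P : HeightOneSpectrum (𝓞 K)} (hP : P ∈ primesAbove K d) :
    P ∈ ramSet K L := by
  have hd0 : (d : K) ≠ 0 := by exact_mod_cast hd.ne_zero
  have hs0 : s ≠ 0 := by
    rintro rfl
    have : (d : L) ≠ 0 := by exact_mod_cast hd.ne_zero
    exact this (by simpa using hs.symm)
  refine mem_ramSet_of_odd h2 (s := Units.mk0 s hs0) (a := Units.mk0 (d : K) hd0)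
    (by simpa using hs) P ?_
  rw [elemDiv_natCast (m := 2 ^ (m + 3)) hd (Nat.Coprime.pow_right _ hodd.coprime_two_right) hP
    (Units.val_mk0 hd0)]
  exact odd_one

lemma primesAbove_nonempty {p : ℕ} (hp : IsAdmissible p) (m : ℕ)
    [IsCyclotomicExtension {2 ^ (m + 3)} ℚ K] : (primesAbove K p).Nonempty := by
  refine Set.nonempty_of_ncard_ne_zero fun h ↦ ?_
  have h1 := ncard_primesAbove_mul (K := K) hp.1 (hp.not_dvd (m + 3))
  rw [h, zero_mul, eq_comm, Nat.totient_eq_zero] at h1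
  exact absurd h1 (by positivity)

lemma primesAbove_subset {p d : ℕ} (h : p ∣ d) : primesAbove K p ⊆ primesAbove K d := by
  rintro P hP
  obtain ⟨c, rfl⟩ := h
  simpa [primesAbove] using P.asIdeal.mul_mem_right (c : 𝓞 K) hP

include m F in
theorem normUnits_index (h2 : Module.finrank K L = 2) (hs : s ^ 2 = d)
    (hsK : s ∉ Set.range (algebraMap K L)) (hd : Squarefree d) (hodd : Odd d)
    (hall : ∀ p, p.Prime → p ∣ d → IsAdmissible p)
    {ζ : (𝓞 K)ˣ} (hζ : IsPrimitiveRoot (ζ : 𝓞 K) (2 ^ (m + 3)))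
    (hp5 : ∃ p, p.Prime ∧ p ∣ d ∧ p % 8 = 5) (hp3 : ∃ p, p.Prime ∧ p ∣ d ∧ p % 8 = 3) :
    (normUnits K L).index = 4 := by
  have := isTotallyComplex_two_pow m K
  obtain ⟨p₁, hp₁, hd₁, h₁⟩ := hp5
  obtain ⟨p₂, hp₂, hd₂, h₂⟩ := hp3
  obtain ⟨P₁, hP₁⟩ := primesAbove_nonempty (K := K) (hall p₁ hp₁ hd₁) m
  obtain ⟨P₂, hP₂⟩ := primesAbove_nonempty (K := K) (hall p₂ hp₂ hd₂) m
  have hr₁ := mem_ramSet_of_mem_primesAbove (m := m) h2 hs hd hodd (primesAbove_subset hd₁ hP₁)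
  have hr₂ := mem_ramSet_of_mem_primesAbove (m := m) h2 hs hd hodd (primesAbove_subset hd₂ hP₂)
  obtain ⟨u, hu⟩ := exists_cyclotomicUnit hζ
  have hζN : ζ ∉ normUnits K L := fun h ↦
    not_isSquare_root hζ (hall p₁ hp₁ hd₁) hP₁ (isSquare_of_mem_normUnits h2 hr₁ h)
  have huN : u ∉ normUnits K L := fun h ↦ by
    have := (isSquare_cyclotomicUnit_iff (F := F) hζ hp₂ (.inl h₂) hP₂ hu).1
      (isSquare_of_mem_normUnits h2 hr₂ h)
    omega
  have hζu : ζ * u ∉ normUnits K L := fun h ↦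
    not_isSquare_root hζ (hall p₁ hp₁ hd₁) hP₁ (isSquare_of_mul
      (isSquare_of_mem_normUnits h2 hr₁ h)
      ((isSquare_cyclotomicUnit_iff (F := F) hζ hp₁ (.inr h₁) hP₁ hu).2 h₁))
  obtain ⟨k, hk, hk'⟩ := (Nat.dvd_prime_pow Nat.prime_two).1
    (show (normUnits K L).index ∣ 2 ^ 2 from
      normUnits_index_dvd (F := F) h2 hs hsK hd.ne_zero hall hζ)
  interval_cases k
  · rw [pow_zero, Subgroup.index_eq_one] at hk'
    exact absurd (hk' ▸ Subgroup.mem_top ζ) hζN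
  · exact absurd ((Subgroup.mul_mem_iff_of_index_two hk').2 (iff_of_false hζN huN)) hζu
  · exact hk'

end Index

section Genus

open IsDedekindDomain IsCyclotomicExtension

universe u

variable {m : ℕ} {K : Type u} {F : Type*} [Field K] [NumberField K]
  [IsCyclotomicExtension {2 ^ (m + 3)} ℚ K]
  [Field F] [NumberField F] [IsCyclotomicExtension {2 ^ 3} ℚ F] [Algebra F K] [IsGalois F K]
  {L : Type u} [Field L] [NumberField L] [Algebra K L] {d : ℕ} {s : L}

include m in
lemma sqrt_notMem_range (hs : s ^ 2 = d) (hd : Squarefree d) (hodd : Odd d)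
    {p : ℕ} (hp : IsAdmissible p) (hpd : p ∣ d) : s ∉ Set.range (algebraMap K L) := by
  rintro ⟨x, rfl⟩
  have hx : x ^ 2 = d := (algebraMap K L).injective (by simpa using hs)
  have hd0 : (d : K) ≠ 0 := by exact_mod_cast hd.ne_zero
  have hx0 : x ≠ 0 := by
    rintro rfl
    exact hd0 (by simpa using hx.symm)
  obtain ⟨P, hP⟩ := primesAbove_nonempty (K := K) hp m
  have h1 := elemDiv_natCast (m := 2 ^ (m + 3)) (x := Units.mk0 x hx0 ^ 2) hd
    (Nat.Coprime.pow_right _ hodd.coprime_two_right) (primesAbove_subset hpd hP) (by simpa using hx)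
  rw [map_pow, toAdd_pow, Finsupp.smul_apply, two_nsmul] at h1
  omega

include m in
lemma ramSet_eq_primesAbove (h2 : Module.finrank K L = 2) (hs : s ^ 2 = d)
    (hsK : s ∉ Set.range (algebraMap K L)) (hd : Squarefree d) (hodd : Odd d)
    {ζ : 𝓞 K} (hζ : IsPrimitiveRoot ζ (2 ^ (m + 3))) :
    ramSet K L = primesAbove K d := by
  refine Set.Subset.antisymm (fun P hP ↦ ?_)
    fun P hP ↦ mem_ramSet_of_mem_primesAbove (m := m) h2 hs hd hodd hP
  rcases Nat.odd_mod_four_iff.1 (Nat.odd_iff.1 hodd) with h | h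
  · obtain ⟨c, rfl⟩ : ∃ c, d = 4 * c + 1 := ⟨d / 4, by omega⟩
    exact mem_of_one_mod_four h2 (a := ((4 * c + 1 : ℕ) : 𝓞 K)) (b := (c : 𝓞 K)) (by push_cast; rfl)
      (by rw [hs, map_natCast]) hsK hP
  · obtain ⟨c, rfl⟩ : ∃ c, d = 4 * c + 3 := ⟨d / 4, by omega⟩
    have hi : (ζ ^ 2 ^ (m + 1)) ^ 2 = -1 := by
      rw [← pow_mul, ← pow_succ]
      exact (hζ.pow (by positivity) (by rw [pow_succ])).eq_neg_one_of_two_right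
    set i := ζ ^ 2 ^ (m + 1)
    have hi0 : algebraMap (𝓞 K) K i ≠ 0 := by
      rw [map_ne_zero_iff _ RingOfIntegers.coe_injective]
      intro h0
      rw [h0] at hi
      simp at hi
    have h4 := mem_of_one_mod_four h2 (a := -((4 * c + 3 : ℕ) : 𝓞 K)) (b := -(c + 1 : 𝓞 K))
      (s := algebraMap K L (algebraMap (𝓞 K) K i) * s) (by push_cast; ring)
      (by
        rw [mul_pow, hs, ← IsScalarTower.algebraMap_apply, ← map_pow, hi, map_neg, map_one,
          map_neg, map_natCast, neg_one_mul])
      (by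
        rintro ⟨x, hx⟩
        refine hsK ⟨x / algebraMap (𝓞 K) K i, ?_⟩
        rw [map_div₀, hx, mul_div_cancel_left₀]
        exact (map_ne_zero _).2 hi0) hP
    exact neg_mem_iff.1 h4

lemma ncard_primesAbove_prime {p : ℕ} (hp : IsAdmissible p) (m : ℕ)
    [IsCyclotomicExtension {2 ^ (m + 3)} ℚ K] :
    (primesAbove K p).ncard = if p % 16 = 9 then 4 else 2 := by
  have h := ncard_primesAbove_mul (K := K) hp.1 (hp.not_dvd (m + 3))
  rw [Nat.totient_prime_pow_succ Nat.prime_two, show 2 - 1 = 1 from rfl, mul_one] at h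
  split_ifs with h9
  · rw [orderOf_of_mod_sixteen h9 m] at h
    exact Nat.eq_of_mul_eq_mul_right (show 0 < 2 ^ m by positivity) (by rw [h]; ring)
  · have h' : p % 8 = 3 ∨ p % 8 = 5 := by
      have := hp.2
      tauto
    rw [orderOf_of_sq_mod_sixteen h' m] at h
    exact Nat.eq_of_mul_eq_mul_right (show 0 < 2 * 2 ^ m by positivity) (by rw [h]; ring)

lemma ncard_primesAbove_radicand (hd : d ≠ 0) (hall : ∀ p, p.Prime → p ∣ d → IsAdmissible p)
    (m : ℕ) [IsCyclotomicExtension {2 ^ (m + 3)} ℚ K] :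
    (primesAbove K d).ncard = 4 * {p : ℕ | p.Prime ∧ p ∣ d ∧ p % 16 = 9}.ncard +
      2 * {p : ℕ | p.Prime ∧ p ∣ d ∧ (p % 8 = 3 ∨ p % 8 = 5)}.ncard := by
  rw [(ncard_primesAbove_eq_sum hd).2, Finset.sum_congr rfl fun p hp ↦
    ncard_primesAbove_prime (hall p (Nat.prime_of_mem_primeFactors hp)
      (Nat.dvd_of_mem_primeFactors hp)) m, Finset.sum_ite, Finset.sum_const, Finset.sum_const,
    smul_eq_mul, smul_eq_mul, mul_comm, mul_comm _ 2, ← Set.ncard_coe_finset,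
    ← Set.ncard_coe_finset]
  congr! 3
  · ext p
    simp [hd, and_assoc]
  · ext p
    simp only [Finset.coe_filter, Nat.mem_primeFactors, Set.mem_ofPred_eq]
    constructor
    · rintro ⟨⟨hp, hpd, -⟩, h⟩
      have := (hall p hp hpd).2
      exact ⟨hp, hpd, by tauto⟩
    · rintro ⟨hp, hpd, h⟩
      exact ⟨⟨hp, hpd, hd⟩, by omega⟩

include m F in
theorem index_squares_eq (h2 : Module.finrank K L = 2) (hs : s ^ 2 = d)
    (hd : Squarefree d) (hodd : Odd d)
    (hall : ∀ p, p.Prime → p ∣ d → IsAdmissible p)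
    {ζ : (𝓞 K)ˣ} (hζ : IsPrimitiveRoot (ζ : 𝓞 K) (2 ^ (m + 3)))
    (hp5 : ∃ p, p.Prime ∧ p ∣ d ∧ p % 8 = 5) (hp3 : ∃ p, p.Prime ∧ p ∣ d ∧ p % 8 = 3) :
    (powMonoidHom 2 : ClassGroup (𝓞 L) →* ClassGroup (𝓞 L)).range.index * 2 ^ 3 =
      2 ^ (4 * {p : ℕ | p.Prime ∧ p ∣ d ∧ p % 16 = 9}.ncard +
        2 * {p : ℕ | p.Prime ∧ p ∣ d ∧ (p % 8 = 3 ∨ p % 8 = 5)}.ncard) := by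
  have := isTotallyComplex_two_pow m K
  have hsK : s ∉ Set.range (algebraMap K L) := by
    obtain ⟨p, hp, hpd, -⟩ := hp5
    exact sqrt_notMem_range (m := m) hs hd hodd (hall p hp hpd) hpd
  have hram := ramSet_eq_primesAbove h2 hs hsK hd hodd hζ
  have h := index_squares_classGroup h2 (hram ▸ (ncard_primesAbove_eq_sum hd.ne_zero).1)
    (odd_card_classGroup_cyclotomic (m + 1) K)
  rw [hram, ncard_primesAbove_radicand hd.ne_zero hall m,
    normUnits_index (F := F) h2 hs hsK hd hodd hall hζ hp5 hp3] at h
  exact h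

end Genus

section Field

lemma finrank_eq_two_of_adjoin {E L : Type*} [Field E] [Field L] [Algebra E L] {s : L} {a : E}
    (hs : s ^ 2 = algebraMap E L a) (hsE : s ∉ Set.range (algebraMap E L)) (h : E⟮s⟯ = ⊤) :
    Module.finrank E L = 2 := by
  have hsint : IsIntegral E s := IsIntegral.of_pow two_pos (hs ▸ isIntegral_algebraMap)
  rw [← finrank_top', ← h, adjoin.finrank hsint]
  refine le_antisymm ?_ ?_
  · have h1 := minpoly.min E s (Polynomial.monic_X_pow_sub_C a two_ne_zero) (by simp [hs])
    have h3 := Polynomial.natDegree_le_natDegree h1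
    rwa [Polynomial.natDegree_X_pow_sub_C] at h3
  · have h1 := minpoly.natDegree_pos hsint
    have h3 : (minpoly E s).natDegree ≠ 1 := fun h ↦ hsE (minpoly.natDegree_eq_one_iff.1 h)
    omega

lemma closure_squares (G : Type*) [CommGroup G] :
    Subgroup.closure {x : G | ∃ y, x = y ^ 2} = (powMonoidHom 2 : G →* G).range := by
  refine le_antisymm ((Subgroup.closure_le _).2 ?_) ?_
  · rintro _ ⟨y, rfl⟩
    exact ⟨y, rfl⟩
  · rintro _ ⟨y, rfl⟩
    exact Subgroup.subset_closure ⟨y, rfl⟩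

end Field

end AmbiguousClass

/-- Theorem 3.1(1): for n ≥ 3 and d > 2 odd composite square-free with all prime
divisors ≡ ±3 (mod 8) or ≡ 9 (mod 16), if d has prime divisors p₁ ≡ 5 (mod 8) and
p₂ ≡ 3 (mod 8), then rank₂(Cl(Q(ζ_{2^n}, √d))) = t − 3 where t = 4q + 2r. -/
theorem stmt_16 (n : ℕ) (hn : 3 ≤ n) (d : ℕ) (hd2 : 2 < d) (hodd : Odd d)
    (hsf : Squarefree d) (hcomp : ¬ d.Prime)
    (hall : ∀ p : ℕ, p.Prime → p ∣ d → (p % 8 = 3 ∨ p % 8 = 5 ∨ p % 16 = 9))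
    (r q t : ℕ)
    (hr : r = {p : ℕ | p.Prime ∧ p ∣ d ∧ (p % 8 = 3 ∨ p % 8 = 5)}.ncard)
    (hq : q = {p : ℕ | p.Prime ∧ p ∣ d ∧ p % 16 = 9}.ncard)
    (ht : t = 4 * q + 2 * r)
    (hp5 : ∃ p₁ : ℕ, p₁.Prime ∧ p₁ ∣ d ∧ p₁ % 8 = 5)
    (hp3 : ∃ p₂ : ℕ, p₂.Prime ∧ p₂ ∣ d ∧ p₂ % 8 = 3)
    (L : Type*) [Field L] [NumberField L] (ζ s : L)
    (hζ : IsPrimitiveRoot ζ (2 ^ n)) (hs : s ^ 2 = (d : L))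
    (hL : IntermediateField.adjoin ℚ {ζ, s} = ⊤) :
    rank2 L = t - 3 := by
  obtain ⟨m, rfl⟩ : ∃ m, n = m + 3 := ⟨n - 3, by omega⟩
  have hadm : ∀ p, p.Prime → p ∣ d → AmbiguousClass.IsAdmissible p :=
    fun p hp hpd ↦ ⟨hp, hall p hp hpd⟩
  let K := ℚ⟮ζ⟯
  have hK : IsCyclotomicExtension {2 ^ (m + 3)} ℚ K :=
    (isCyclotomicExtension_singleton_iff_eq_adjoin _ _ _ _ hζ).mpr rfl
  let z : K := ⟨ζ, mem_adjoin_simple_self ℚ _⟩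
  have hz : IsPrimitiveRoot z (2 ^ (m + 3)) :=
    IsPrimitiveRoot.of_map_of_injective (f := algebraMap K L) hζ (algebraMap K L).injective
  have hη : IsPrimitiveRoot (z ^ 2 ^ m) (2 ^ 3) := hz.pow (by positivity) (pow_add _ _ _)
  let F := ℚ⟮z ^ 2 ^ m⟯
  have hF : IsCyclotomicExtension {2 ^ 3} ℚ F :=
    (isCyclotomicExtension_singleton_iff_eq_adjoin _ _ _ _ hη).mpr rfl
  have : IsGalois ℚ K := IsCyclotomicExtension.isGalois {2 ^ (m + 3)} ℚ K
  obtain ⟨p, hp, hpd, -⟩ := id hp5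
  have hKs : K⟮s⟯ = ⊤ := by
    rw [← restrictScalars_eq_top_iff (K := ℚ)]
    exact (adjoin_adjoin_left ℚ {ζ} {s}).trans (by rw [Set.singleton_union, hL])
  have h2 : Module.finrank K L = 2 :=
    AmbiguousClass.finrank_eq_two_of_adjoin (a := (d : K)) (by simpa using hs)
      (AmbiguousClass.sqrt_notMem_range (m := m) hs hsf hodd (hadm p hp hpd) hpd) hKs
  have h := AmbiguousClass.index_squares_eq (F := F) h2 hs hsf hodd hadm
    (ζ := (hz.toInteger_isPrimitiveRoot.isUnit (by positivity)).unit)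
    hz.toInteger_isPrimitiveRoot hp5 hp3
  rw [← hq, ← hr, ← ht] at h
  have ht3 : 3 ≤ t := (Nat.pow_dvd_pow_iff_le_right (by norm_num)).1 (Dvd.intro_left _ h)
  rw [← Nat.sub_add_cancel ht3, pow_add 2 (t - 3)] at h
  rw [rank2, AmbiguousClass.closure_squares, ← Subgroup.index,
    Nat.eq_of_mul_eq_mul_right (by positivity) h, Nat.log_pow (by norm_num)]
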